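/- arXiv:2308.16794 — 4 statements merged into one kernel-verified Lean document; each statement's English description precedes it below -/
import Mathlib

section
/- Let s ∈ (0,1/2). Let (ρ_n) be a sequence of nonzero 2π-periodic measurable functions ℝ → ℝ, square-integrable on (0,2π), such that ρ̂_n(k) = 0 for all |k| ≤ 1, Q(ρ_n) < ∞, Q(ρ_n) → 0 as n → ∞, and, writing u_n = 1 + ρ_n, limsup_{n→∞} [Q(u_n) − S_{1,s}·(∫₀^{2π}|u_n(θ)|^p dθ)^{2/p}] / Q(ρ_n) ≤ 4s/(3+2s). Then there exist N ∈ ℕ and sequences θ_n ∈ [0,2π), μ_n > 0, and 2π-periodic square-integrable functions η_n with η̂_n(k) = 0 for all |k| ≤ 2, such that for every n ≥ N one has ρ_n(θ) = μ_n·(sin(2(θ−θ_n)) + η_n(θ)) for almost every θ, and moreover μ_n → 0 and Q(η_n) → 0 as n → ∞. -/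
open MeasureTheory Real Filter
open scoped ENNReal

/-- `α(ℓ) = Γ(ℓ + 1/2 + s) / Γ(ℓ + 1/2 - s)`. -/
noncomputable def alphaF (s : ℝ) (l : ℕ) : ℝ :=
  Real.Gamma ((l : ℝ) + 1/2 + s) / Real.Gamma ((l : ℝ) + 1/2 - s)

/-- Fourier coefficient `û(k) = (2π)⁻¹ ∫₀^{2π} u(θ) e^{-ikθ} dθ`. -/
noncomputable def fCoeff (u : ℝ → ℝ) (k : ℤ) : ℂ :=
  (2 * (Real.pi : ℂ))⁻¹ *
    ∫ θ in (0:ℝ)..(2 * Real.pi), (u θ : ℂ) * Complex.exp (-(Complex.I * k * θ))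

/-- The quadratic form `Q(u) = 2π ∑_{k ∈ ℤ} α(|k|) |û(k)|² ∈ [0,∞]`. -/
noncomputable def Qform (s : ℝ) (u : ℝ → ℝ) : ℝ≥0∞ :=
  ENNReal.ofReal (2 * Real.pi) *
    ∑' k : ℤ, ENNReal.ofReal (alphaF s k.natAbs * ‖fCoeff u k‖ ^ 2)


lemma alphaF_pos {s : ℝ} (hs : s ∈ Set.Ioo (0:ℝ) (1/2)) (l : ℕ) : 0 < alphaF s l := by
  have h0 : (0:ℝ) ≤ l := Nat.cast_nonneg l
  exact div_pos (Real.Gamma_pos_of_pos (by linarith [hs.1])) (Real.Gamma_pos_of_pos (by linarith [hs.2]))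

lemma alphaF_succ {s : ℝ} (hs : s ∈ Set.Ioo (0:ℝ) (1/2)) (l : ℕ) :
    alphaF s (l+1) = alphaF s l * (((l:ℝ) + 1/2 + s) / ((l:ℝ) + 1/2 - s)) := by
  have h0 : (0:ℝ) ≤ l := Nat.cast_nonneg l
  unfold alphaF
  rw [show (((l+1:ℕ):ℝ) + 1/2 + s) = ((l:ℝ) + 1/2 + s) + 1 by push_cast; ring,
    show (((l+1:ℕ):ℝ) + 1/2 - s) = ((l:ℝ) + 1/2 - s) + 1 by push_cast; ring,
    Real.Gamma_add_one (by linarith [hs.1]), Real.Gamma_add_one (by linarith [hs.2])]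
  rw [mul_div_mul_comm, mul_comm]

lemma alphaF_lt_succ {s : ℝ} (hs : s ∈ Set.Ioo (0:ℝ) (1/2)) (l : ℕ) :
    alphaF s l < alphaF s (l+1) := by
  have h0 : (0:ℝ) ≤ l := Nat.cast_nonneg l
  rw [alphaF_succ hs]
  have : 1 < ((l:ℝ) + 1/2 + s) / ((l:ℝ) + 1/2 - s) := by
    rw [one_lt_div (by linarith [hs.2])]; linarith [hs.1]
  nlinarith [alphaF_pos hs l]

lemma alphaF_strictMono {s : ℝ} (hs : s ∈ Set.Ioo (0:ℝ) (1/2)) : StrictMono (alphaF s) :=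
  strictMono_nat_of_lt_succ (alphaF_lt_succ hs)

lemma alphaF_lower {s : ℝ} (hs : s ∈ Set.Ioo (0:ℝ) (1/2)) (l : ℕ) :
    alphaF s 0 * ((l:ℝ)+1) ^ (2*s) ≤ alphaF s l := by
  have hs1 := hs.1
  have hs2 := hs.2
  induction l with
  | zero => simp
  | succ l ih =>
    have h0 : (0:ℝ) ≤ l := Nat.cast_nonneg l
    have hl : (0:ℝ) < (l:ℝ) + 1 := by linarith
    rw [alphaF_succ hs]
    have e : (((l+1:ℕ):ℝ)+1) = ((l:ℝ)+1) * (1 + 1/((l:ℝ)+1)) := by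
      push_cast; field_simp
    rw [e, Real.mul_rpow hl.le (by positivity), ← mul_assoc]
    have b : (1 + 1/((l:ℝ)+1)) ^ (2*s) ≤ ((l:ℝ) + 1/2 + s) / ((l:ℝ) + 1/2 - s) := by
      refine (rpow_one_add_le_one_add_mul_self (by have : 0 ≤ 1/((l:ℝ)+1) := by positivity
                                                   linarith) (by linarith) (by linarith)).trans ?_
      rw [le_div_iff₀ (by linarith)]
      have h1 : 1/((l:ℝ)+1) * ((l:ℝ) + 1/2 - s) ≤ 1 := by
        rw [div_mul_eq_mul_div, div_le_one hl]; linarith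
      nlinarith
    exact mul_le_mul ih b (by positivity) (alphaF_pos hs l).le

/-- complex Fourier coefficient -/
noncomputable def cC (f : ℝ → ℂ) (k : ℤ) : ℂ :=
  (2 * (Real.pi : ℂ))⁻¹ *
    ∫ θ in (0:ℝ)..(2 * Real.pi), f θ * Complex.exp (-(Complex.I * k * θ))

lemma fCoeff_eq_cC (u : ℝ → ℝ) (k : ℤ) : fCoeff u k = cC (fun θ => (u θ : ℂ)) k := rfl

lemma cC_eq (f : ℝ → ℂ) (k : ℤ) : cC f k = fourierCoeffOn Real.two_pi_pos f k := by
  rw [fourierCoeffOn_eq_integral, cC]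
  simp only [sub_zero, smul_eq_mul]
  rw [Complex.real_smul]
  congr 1
  · push_cast; simp
  · apply intervalIntegral.integral_congr
    intro x _
    simp only
    rw [fourier_coe_apply, mul_comm]
    congr 2
    have : (Real.pi : ℂ) ≠ 0 := by exact_mod_cast Real.pi_ne_zero
    push_cast
    rw [sub_zero]
    field_simp

lemma parseval {f : ℝ → ℂ} (hf : MemLp f 2 (volume.restrict (Set.Ioc 0 (2*Real.pi)))) :
    HasSum (fun k => ‖cC f k‖^2) ((2*Real.pi)⁻¹ * ∫ x in (0:ℝ)..(2*Real.pi), ‖f x‖^2) := by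
  have := hasSum_sq_fourierCoeffOn Real.two_pi_pos hf
  simpa only [cC_eq, sub_zero, smul_eq_mul] using this

lemma cC_exp (j k : ℤ) : cC (fun θ => Complex.exp (Complex.I * j * θ)) k = if k = j then 1 else 0 := by
  have hpi : (Real.pi : ℂ) ≠ 0 := by exact_mod_cast Real.pi_ne_zero
  unfold cC
  have : ∀ θ : ℝ, Complex.exp (Complex.I * j * θ) * Complex.exp (-(Complex.I * k * θ))
      = Complex.exp ((Complex.I * (j - k)) * θ) := by
    intro θ; rw [← Complex.exp_add]; congr 1; ring
  simp_rw [this]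
  split_ifs with h
  · subst h; simp; field_simp
  · have hjk : (j:ℂ) - k ≠ 0 := by
      rw [sub_ne_zero]; exact_mod_cast (Ne.symm h)
    rw [integral_exp_mul_complex (mul_ne_zero Complex.I_ne_zero hjk)]
    have : Complex.exp (Complex.I * (j - k) * ((2 * Real.pi : ℝ) : ℂ)) = 1 := by
      rw [Complex.exp_eq_one_iff]
      exact ⟨j - k, by push_cast; ring⟩
    rw [this]; simp

lemma cC_add {f g : ℝ → ℂ} (hf : IntervalIntegrable f volume 0 (2*Real.pi))
    (hg : IntervalIntegrable g volume 0 (2*Real.pi)) (k : ℤ) :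
    cC (fun θ => f θ + g θ) k = cC f k + cC g k := by
  unfold cC
  simp_rw [add_mul]
  rw [intervalIntegral.integral_add, mul_add]
  · exact hf.mul_continuousOn (by fun_prop)
  · exact hg.mul_continuousOn (by fun_prop)

lemma cC_const_mul (c : ℂ) (f : ℝ → ℂ) (k : ℤ) : cC (fun θ => c * f θ) k = c * cC f k := by
  unfold cC
  simp_rw [mul_assoc]
  rw [intervalIntegral.integral_const_mul]; ring

lemma cC_trig (F : Finset ℤ) (c : ℤ → ℂ) (k : ℤ) :
    cC (fun θ => ∑ j ∈ F, c j * Complex.exp (Complex.I * j * θ)) k = if k ∈ F then c k else 0 := by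
  classical
  induction F using Finset.induction_on with
  | empty => simp [cC]
  | insert a F ha ih =>
    simp_rw [Finset.sum_insert ha]
    rw [cC_add (Continuous.intervalIntegrable (by fun_prop) _ _)
      (Continuous.intervalIntegrable (by fun_prop) _ _), ih, cC_const_mul, cC_exp]
    by_cases h : k = a
    · subst h; simp [ha]
    · simp [h]

lemma sum_weights {s : ℝ} (hs : s ∈ Set.Ioo (0:ℝ) (1/2)) (N : ℕ) :
    ∑ m ∈ Finset.range N, ((m:ℝ)+1) ^ (-(2*s)) ≤ (N:ℝ) ^ (1-2*s) / (1-2*s) := by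
  have hs1 := hs.1
  have hs2 := hs.2
  induction N with
  | zero => simp; rw [Real.zero_rpow (by linarith)]; simp
  | succ N ih =>
    rw [Finset.sum_range_succ]
    have hN : (0:ℝ) < (N:ℝ)+1 := by positivity
    have hb : (N:ℝ) ^ (1-2*s) ≤ ((N:ℝ)+1) ^ (1-2*s) * (1 + (1-2*s) * (-(1/((N:ℝ)+1)))) := by
      have e : (N:ℝ) = ((N:ℝ)+1) * (1 + (-(1/((N:ℝ)+1)))) := by field_simp; ring
      have h1 : 1/((N:ℝ)+1) ≤ 1 := by rw [div_le_one hN]; linarith [(Nat.cast_nonneg N : (0:ℝ) ≤ N)]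
      conv_lhs => rw [e]
      rw [Real.mul_rpow hN.le (by linarith)]
      gcongr
      exact rpow_one_add_le_one_add_mul_self (by linarith) (by linarith) (by linarith)
    have e2 : ((N:ℝ)+1) ^ (-(2*s)) = ((N:ℝ)+1) ^ (1-2*s) * (1/((N:ℝ)+1)) := by
      rw [show (1-2*s) = -(2*s) + 1 by ring, Real.rpow_add_one hN.ne']; field_simp
    have h3 : (N:ℝ) ^ (1-2*s) / (1-2*s) + ((N:ℝ)+1) ^ (-(2*s)) ≤ ((N:ℝ)+1) ^ (1-2*s)/(1-2*s) := by
      rw [div_add' _ _ _ (by linarith), div_le_div_iff_of_pos_right (by linarith), e2]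
      nlinarith
    push_cast
    linarith

lemma sum_weights_int {s X : ℝ} (hs : s ∈ Set.Ioo (0:ℝ) (1/2)) (hX : 0 ≤ X) (F : Finset ℤ)
    (hF : ∀ k ∈ F, ((k.natAbs:ℝ)+1) ^ (1-2*s) ≤ X) :
    ∑ k ∈ F, ((k.natAbs:ℝ)+1) ^ (-(2*s)) ≤ 2 * X / (1-2*s) := by
  classical
  have hs1 := hs.1
  have hs2 := hs.2
  rcases F.eq_empty_or_nonempty with rfl | hne
  · simp only [Finset.sum_empty]; exact div_nonneg (by linarith) (by linarith)
  obtain ⟨k0, hk0, hmax⟩ := F.exists_max_image Int.natAbs hne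
  set N := k0.natAbs + 1 with hN
  have key : ∀ G : Finset ℤ, G ⊆ F → Set.InjOn Int.natAbs (G : Set ℤ) →
      ∑ k ∈ G, ((k.natAbs:ℝ)+1) ^ (-(2*s)) ≤ X / (1-2*s) := by
    intro G hG hinj
    have : ∑ k ∈ G, ((k.natAbs:ℝ)+1) ^ (-(2*s)) = ∑ m ∈ G.image Int.natAbs, ((m:ℝ)+1) ^ (-(2*s)) :=
      (Finset.sum_image (f := fun m : ℕ => ((m:ℝ)+1) ^ (-(2*s))) hinj).symm
    rw [this]
    calc _ ≤ ∑ m ∈ Finset.range N, ((m:ℝ)+1) ^ (-(2*s)) := by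
          apply Finset.sum_le_sum_of_subset_of_nonneg
          · intro m hm
            obtain ⟨k, hk, rfl⟩ := Finset.mem_image.1 hm
            have := hmax k (hG hk)
            simp; omega
          · intros; positivity
      _ ≤ _ := sum_weights hs N
      _ ≤ _ := by
          have := hF k0 hk0
          rw [hN]; push_cast
          gcongr
          linarith
  rw [← Finset.sum_filter_add_sum_filter_not F (fun k => 0 ≤ k)]
  have h1 := key (F.filter (fun k => 0 ≤ k)) (Finset.filter_subset _ _) (by
    intro a ha b hb h; simp at ha hb; omega)
  have h2 := key (F.filter (fun k => ¬ 0 ≤ k)) (Finset.filter_subset _ _) (by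
    intro a ha b hb h; simp at ha hb; omega)
  calc _ ≤ X / (1-2*s) + X / (1-2*s) := add_le_add h1 h2
    _ = _ := by ring

lemma sobolev_level {s : ℝ} (hs : s ∈ Set.Ioo (0:ℝ) (1/2)) {f : ℝ → ℂ}
    (hf : MemLp f 2 (volume.restrict (Set.Ioc 0 (2*Real.pi)))) {M : ℝ} (hM : 0 < M)
    (hsum : ∑' k : ℤ, ENNReal.ofReal (((k.natAbs:ℝ)+1) ^ (2*s) * ‖cC f k‖^2) ≤ ENNReal.ofReal M)
    {B : ℝ} (hB : 0 < B) (hB2 : B^2 = 8 * M / (1-2*s)) {t : ℝ} (ht : 0 < t) :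
    volume.restrict (Set.Ioc 0 (2*Real.pi)) {θ | t < ‖f θ‖} ≤
      ∑' k : ℤ, ENNReal.ofReal (8 * Real.pi / t^2) *
        (if t < B * ((k.natAbs:ℝ)+1)^(1/2-s) then ENNReal.ofReal (‖cC f k‖^2) else 0) := by
  classical
  have hs1 := hs.1
  have hs2 := hs.2
  have hfin : {k : ℤ | B * ((k.natAbs:ℝ)+1)^(1/2-s) ≤ t}.Finite := by
    have hto : Tendsto (fun k : ℤ => B * ((k.natAbs:ℝ)+1)^(1/2-s)) cofinite atTop := by
      apply Tendsto.const_mul_atTop hB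
      apply (tendsto_rpow_atTop (by linarith : 0 < 1/2-s)).comp
      apply tendsto_atTop_add_const_right
      have : Tendsto (fun k : ℤ => ‖k‖) cofinite atTop := by
        have := tendsto_norm_cocompact_atTop (E := ℤ)
        rwa [cocompact_eq_cofinite] at this
      refine this.congr fun k => ?_
      rw [Int.norm_eq_abs]; simp [Nat.cast_natAbs]
    have := hto.eventually (eventually_gt_atTop t)
    rw [eventually_cofinite] at this
    simpa using this
  set F := hfin.toFinset with hFdef
  have hFm : ∀ k, k ∈ F ↔ B * ((k.natAbs:ℝ)+1)^(1/2-s) ≤ t := by intro k; simp [hFdef]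
  -- low frequency bound
  have hlow : ∑ k ∈ F, ‖cC f k‖ ≤ t/2 := by
    have hMF : ∑ k ∈ F, (((k.natAbs:ℝ)+1) ^ (2*s) * ‖cC f k‖^2) ≤ M := by
      have h1 : ∑ k ∈ F, ENNReal.ofReal (((k.natAbs:ℝ)+1) ^ (2*s) * ‖cC f k‖^2) ≤ ENNReal.ofReal M :=
        (ENNReal.sum_le_tsum F).trans hsum
      rw [← ENNReal.ofReal_sum_of_nonneg (by intros; positivity)] at h1
      exact (ENNReal.ofReal_le_ofReal_iff hM.le).1 h1
    have hW : ∑ k ∈ F, ((k.natAbs:ℝ)+1) ^ (-(2*s)) ≤ 2 * (t/B)^2 / (1-2*s) := by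
      apply sum_weights_int hs (by positivity)
      intro k hk
      have h1 : ((k.natAbs:ℝ)+1)^(1/2-s) ≤ t/B := by
        rw [le_div_iff₀ hB, mul_comm]; exact (hFm k).1 hk
      have h2 : ((k.natAbs:ℝ)+1)^(1-2*s) = (((k.natAbs:ℝ)+1)^(1/2-s))^2 := by
        rw [← Real.rpow_natCast, ← Real.rpow_mul (by positivity)]; congr 1; push_cast; ring
      rw [h2]; gcongr
    have hCS := Finset.sum_mul_sq_le_sq_mul_sq F (fun k : ℤ => ((k.natAbs:ℝ)+1)^s * ‖cC f k‖)
      (fun k : ℤ => ((k.natAbs:ℝ)+1)^(-s))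
    have e1 : ∀ k : ℤ, ((k.natAbs:ℝ)+1)^s * ‖cC f k‖ * ((k.natAbs:ℝ)+1)^(-s) = ‖cC f k‖ := by
      intro k
      have hp : (0:ℝ) < (k.natAbs:ℝ)+1 := by positivity
      rw [Real.rpow_neg hp.le]
      field_simp
    have e2 : ∀ k : ℤ, (((k.natAbs:ℝ)+1)^s * ‖cC f k‖)^2 = ((k.natAbs:ℝ)+1) ^ (2*s) * ‖cC f k‖^2 := by
      intro k
      rw [mul_pow, ← Real.rpow_natCast (((k.natAbs:ℝ)+1)^s), ← Real.rpow_mul (by positivity)]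
      congr 2; push_cast; ring
    have e3 : ∀ k : ℤ, (((k.natAbs:ℝ)+1)^(-s))^2 = ((k.natAbs:ℝ)+1) ^ (-(2*s)) := by
      intro k
      rw [← Real.rpow_natCast, ← Real.rpow_mul (by positivity)]
      congr 1; push_cast; ring
    simp only [e1, e2, e3] at hCS
    have : (∑ k ∈ F, ‖cC f k‖)^2 ≤ (t/2)^2 := by
      calc _ ≤ _ := hCS
        _ ≤ M * (2 * (t/B)^2 / (1-2*s)) := by
          apply mul_le_mul hMF hW (Finset.sum_nonneg (by intros; positivity)) hM.le
        _ = (t/2)^2 := by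
          rw [div_pow, hB2]
          have : 1-2*s ≠ 0 := by linarith
          field_simp; norm_num
    exact (le_abs_self _).trans (abs_le_of_sq_le_sq this (by positivity))
  set g : ℝ → ℂ := fun θ => f θ + ∑ j ∈ F, (-cC f j) * Complex.exp (Complex.I * j * θ) with hg
  have hcont : Continuous (fun θ : ℝ => ∑ j ∈ F, (-cC f j) * Complex.exp (Complex.I * j * θ)) := by
    fun_prop
  have hbd : ∀ θ : ℝ, ‖∑ j ∈ F, (-cC f j) * Complex.exp (Complex.I * j * θ)‖ ≤ t/2 := by
    intro θ
    refine (norm_sum_le _ _).trans (le_trans (le_of_eq ?_) hlow)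
    apply Finset.sum_congr rfl
    intro j _
    rw [norm_mul, norm_neg, show Complex.I * j * θ = ((j * θ : ℝ) : ℂ) * Complex.I by push_cast; ring,
      Complex.norm_exp_ofReal_mul_I, mul_one]
  have hgL : MemLp g 2 (volume.restrict (Set.Ioc 0 (2*Real.pi))) := by
    apply hf.add
    exact MemLp.of_bound hcont.aestronglyMeasurable (t/2) (Eventually.of_forall hbd)
  have hfI : IntervalIntegrable f volume 0 (2*Real.pi) := by
    rw [intervalIntegrable_iff_integrableOn_Ioc_of_le Real.two_pi_pos.le]
    exact hf.integrable (by norm_num)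
  have hgc : ∀ k, cC g k = if k ∈ F then 0 else cC f k := by
    intro k
    rw [hg, cC_add hfI (hcont.intervalIntegrable _ _), cC_trig F (fun j => -cC f j)]
    split_ifs <;> simp
  have hP := parseval hgL
  have hint : Integrable (fun θ => ‖g θ‖^2) (volume.restrict (Set.Ioc 0 (2*Real.pi))) := by
    exact_mod_cast hgL.integrable_norm_pow (by norm_num)
  have hlin : ∫⁻ θ in Set.Ioc 0 (2*Real.pi), ENNReal.ofReal (‖g θ‖^2) =
      ENNReal.ofReal (2*Real.pi) * ∑' k : ℤ, ENNReal.ofReal (‖cC g k‖^2) := by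
    rw [← ofReal_integral_eq_lintegral_ofReal hint (Eventually.of_forall (by intro; positivity)),
      ← ENNReal.ofReal_tsum_of_nonneg (by intros; positivity) hP.summable, hP.tsum_eq,
      ← ENNReal.ofReal_mul Real.two_pi_pos.le, intervalIntegral.integral_of_le Real.two_pi_pos.le]
    congr 1
    rw [← mul_assoc, mul_inv_cancel₀ Real.two_pi_pos.ne', one_mul]
  have hch := mul_meas_ge_le_lintegral₀ (μ := volume.restrict (Set.Ioc 0 (2*Real.pi)))
    (f := fun θ => ENNReal.ofReal (‖g θ‖^2)) hint.1.aemeasurable.ennreal_ofReal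
    (ENNReal.ofReal ((t/2)^2))
  have hsub : {θ | t < ‖f θ‖} ⊆ {θ | ENNReal.ofReal ((t/2)^2) ≤ ENNReal.ofReal (‖g θ‖^2)} := by
    intro θ hθ
    simp only [Set.mem_ofPred_eq] at hθ ⊢
    apply ENNReal.ofReal_le_ofReal
    have h1 : ‖f θ‖ ≤ ‖g θ‖ + t/2 := by
      have : f θ = g θ - ∑ j ∈ F, (-cC f j) * Complex.exp (Complex.I * j * θ) := by simp [hg]
      rw [this]
      exact (norm_sub_le _ _).trans (add_le_add le_rfl (hbd θ))
    have : t/2 ≤ ‖g θ‖ := by linarith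
    gcongr
  have htt : 0 < (t/2)^2 := by positivity
  have hmain : volume.restrict (Set.Ioc 0 (2*Real.pi)) {θ | t < ‖f θ‖} ≤
      ENNReal.ofReal ((t/2)^2)⁻¹ * (ENNReal.ofReal (2*Real.pi) * ∑' k : ℤ, ENNReal.ofReal (‖cC g k‖^2)) := by
    rw [← hlin]
    refine (measure_mono hsub).trans ?_
    rw [ENNReal.ofReal_inv_of_pos htt, ← ENNReal.div_eq_inv_mul,
      ENNReal.le_div_iff_mul_le (Or.inl (by simpa using ht.ne')) (Or.inl ENNReal.ofReal_ne_top), mul_comm]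
    exact hch
  refine hmain.trans (le_of_eq ?_)
  rw [← mul_assoc, ← ENNReal.ofReal_mul (by positivity), ← ENNReal.tsum_mul_left]
  congr 1; ext k; congr 2
  · field_simp; norm_num
  · rw [hgc]
    by_cases hk : k ∈ F
    · rw [if_pos hk, if_neg (not_lt.2 ((hFm k).1 hk))]; simp
    · rw [if_neg hk, if_pos (lt_of_not_ge (fun h => hk ((hFm k).2 h)))]

lemma lint_pow {q b : ℝ} (hq : -1 < q) (hb : 0 < b) :
    ∫⁻ t in Set.Ioi (0:ℝ), (if t < b then ENNReal.ofReal (t^q) else 0) =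
      ENNReal.ofReal (b^(q+1)/(q+1)) := by
  have h1 : ∀ t, (if t < b then ENNReal.ofReal (t^q) else 0) =
      (Set.Iio b).indicator (fun t => ENNReal.ofReal (t^q)) t := by
    intro t; simp [Set.indicator]
  simp_rw [h1]
  rw [setLIntegral_indicator measurableSet_Iio,
    show Set.Iio b ∩ Set.Ioi 0 = Set.Ioo 0 b by ext; simp [and_comm],
    setLIntegral_congr (Ioo_ae_eq_Ioc)]
  have hi : IntegrableOn (fun t : ℝ => t^q) (Set.Ioc 0 b) := by
    rw [← intervalIntegrable_iff_integrableOn_Ioc_of_le hb.le]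
    exact intervalIntegral.intervalIntegrable_rpow' hq
  rw [← ofReal_integral_eq_lintegral_ofReal hi]
  · rw [← intervalIntegral.integral_of_le hb.le, integral_rpow (Or.inl hq)]
    rw [Real.zero_rpow (by linarith)]; simp
  · filter_upwards [ae_restrict_mem measurableSet_Ioc] with t ht
    exact Real.rpow_nonneg ht.1.le _

lemma sobolev {s : ℝ} (hs : s ∈ Set.Ioo (0:ℝ) (1/2)) : ∃ C : ℝ, 0 < C ∧ ∀ (f : ℝ → ℂ),
    MemLp f 2 (volume.restrict (Set.Ioc 0 (2*Real.pi))) → ∀ M : ℝ, 0 < M →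
    ∑' k : ℤ, ENNReal.ofReal (((k.natAbs:ℝ)+1) ^ (2*s) * ‖cC f k‖^2) ≤ ENNReal.ofReal M →
    ∫⁻ θ in Set.Ioc 0 (2*Real.pi), ENNReal.ofReal (‖f θ‖ ^ (2/(1-2*s))) ≤
      ENNReal.ofReal (C * M ^ (1/(1-2*s))) := by
  have hs1 := hs.1
  have hs2 := hs.2
  have hd : 0 < 1-2*s := by linarith
  set p := 2/(1-2*s) with hp
  have hp2 : 0 < p - 2 := by
    rw [hp, sub_pos, lt_div_iff₀ hd]; linarith
  refine ⟨p * (8*Real.pi) / (p-2) * (8/(1-2*s))^((p-2)/2), by positivity, ?_⟩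
  intro f hf M hM hsum
  set B := Real.sqrt (8*M/(1-2*s)) with hB
  have hBpos : 0 < B := Real.sqrt_pos.2 (by positivity)
  have hB2 : B^2 = 8*M/(1-2*s) := Real.sq_sqrt (by positivity)
  rw [lintegral_rpow_eq_lintegral_meas_lt_mul _ (Eventually.of_forall (fun _ => norm_nonneg _))
    hf.1.norm.aemeasurable (by linarith)]
  have step : ∫⁻ t in Set.Ioi (0:ℝ), volume.restrict (Set.Ioc 0 (2*Real.pi)) {θ | t < ‖f θ‖} *
      ENNReal.ofReal (t^(p-1)) ≤ ∫⁻ t in Set.Ioi (0:ℝ), ∑' k : ℤ,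
        ENNReal.ofReal (8*Real.pi*‖cC f k‖^2) *
          (if t < B * ((k.natAbs:ℝ)+1)^(1/2-s) then ENNReal.ofReal (t^(p-3)) else 0) := by
    apply setLIntegral_mono' measurableSet_Ioi
    intro t ht
    have ht : 0 < t := ht
    refine (mul_le_mul_left (sobolev_level hs hf hM hsum hBpos hB2 ht) _).trans (le_of_eq ?_)
    rw [← ENNReal.tsum_mul_right]
    congr 1; ext k
    split_ifs
    · rw [← ENNReal.ofReal_mul (by positivity), ← ENNReal.ofReal_mul (by positivity),
        ← ENNReal.ofReal_mul (by positivity)]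
      congr 1
      rw [show p - 1 = (p-3) + (2:ℕ) by push_cast; ring, Real.rpow_add_natCast ht.ne']
      field_simp
    · simp
  have step2 : ∫⁻ t in Set.Ioi (0:ℝ), ∑' k : ℤ,
        ENNReal.ofReal (8*Real.pi*‖cC f k‖^2) *
          (if t < B * ((k.natAbs:ℝ)+1)^(1/2-s) then ENNReal.ofReal (t^(p-3)) else 0) =
      ENNReal.ofReal (8*Real.pi/(p-2)*B^(p-2)) *
        ∑' k : ℤ, ENNReal.ofReal (((k.natAbs:ℝ)+1) ^ (2*s) * ‖cC f k‖^2) := by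
    have hmeas : ∀ k : ℤ, Measurable (fun t : ℝ =>
        (if t < B * ((k.natAbs:ℝ)+1)^(1/2-s) then ENNReal.ofReal (t^(p-3)) else 0)) := by
      intro k
      apply Measurable.ite measurableSet_Iio _ measurable_const
      exact (measurable_id.pow_const _).ennreal_ofReal
    rw [lintegral_tsum (fun k => ((hmeas k).const_mul _).aemeasurable), ← ENNReal.tsum_mul_left]
    congr 1; ext k
    rw [lintegral_const_mul _ (hmeas k), lint_pow (by linarith) (by positivity),
      ← ENNReal.ofReal_mul (by positivity), ← ENNReal.ofReal_mul (by positivity)]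
    congr 1
    rw [show p - 3 + 1 = p - 2 by ring, Real.mul_rpow hBpos.le (by positivity),
      ← Real.rpow_mul (by positivity), show (1/2-s)*(p-2) = 2*s by rw [hp]; field_simp; ring]
    field_simp
  calc _ ≤ ENNReal.ofReal p * (ENNReal.ofReal (8*Real.pi/(p-2)*B^(p-2)) * ENNReal.ofReal M) := by
        refine mul_le_mul_right (step.trans ?_) _
        rw [step2]
        exact mul_le_mul_right hsum _
    _ = _ := by
        rw [← ENNReal.ofReal_mul (by positivity), ← ENNReal.ofReal_mul (by linarith)]
        congr 1
        have h1 : B^(p-2) = (8/(1-2*s))^((p-2)/2) * M^((p-2)/2) := by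
          rw [hB, Real.sqrt_eq_rpow, ← Real.rpow_mul (by positivity),
            ← Real.mul_rpow (by positivity) hM.le]
          congr 1 <;> ring
        have h2 : M ^ (1/(1-2*s)) = M^((p-2)/2) * M := by
          rw [← Real.rpow_add_one hM.ne']; congr 1; rw [hp]; field_simp; ring
        rw [h1, h2]; ring

lemma pointwise_near {p ε : ℝ} (hp : 2 < p) (hε : 0 < ε) :
    ∀ᶠ t : ℝ in nhds 0, |1+t|^p ≤ 1 + p*t + (p*(p-1)/2+ε)*t^2 := by
  set h : ℝ → ℝ := fun t => 1 + p*t + (p*(p-1)/2+ε)*t^2 - (1+t)^p with hh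
  have hpos : ∀ᶠ t : ℝ in nhds 0, 0 < 1 + t := by
    have : ContinuousAt (fun t : ℝ => 1 + t) 0 := by fun_prop
    exact this.eventually (lt_mem_nhds (by norm_num))
  have hd1 : ∀ t : ℝ, 0 < 1 + t → HasDerivAt h (p + (p*(p-1)+2*ε)*t - p*(1+t)^(p-1)) t := by
    intro t ht
    have h1 : HasDerivAt (fun t : ℝ => 1 + p*t + (p*(p-1)/2+ε)*t^2) (p + (p*(p-1)+2*ε)*t) t := by
      have := ((hasDerivAt_id t).const_mul p).const_add 1 |>.add
        (((hasDerivAt_id t).pow 2).const_mul (p*(p-1)/2+ε))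
      refine this.congr_deriv ?_
      simp; ring
    have h2 : HasDerivAt (fun t : ℝ => (1+t)^p) (p*(1+t)^(p-1)) t := by
      have := ((hasDerivAt_id t).const_add 1).rpow_const (p := p) (Or.inl ht.ne')
      simpa using this
    exact h1.sub h2
  have hd2 : HasDerivAt (fun t : ℝ => p + (p*(p-1)+2*ε)*t - p*(1+t)^(p-1)) (2*ε) 0 := by
    have h1 : HasDerivAt (fun t : ℝ => p + (p*(p-1)+2*ε)*t) (p*(p-1)+2*ε) 0 := by
      have := ((hasDerivAt_id (0:ℝ)).const_mul (p*(p-1)+2*ε)).const_add p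
      simpa using this
    have h2 : HasDerivAt (fun t : ℝ => p*(1+t)^(p-1)) (p*(p-1)) 0 := by
      have := (((hasDerivAt_id (0:ℝ)).const_add 1).rpow_const (p := p-1) (Or.inl (by simp))).const_mul p
      simpa using this
    refine (h1.sub h2).congr_deriv ?_
    ring
  have hde : deriv h =ᶠ[nhds 0] fun t => p + (p*(p-1)+2*ε)*t - p*(1+t)^(p-1) := by
    filter_upwards [hpos] with t ht using (hd1 t ht).deriv
  have hmin : IsLocalMin h 0 := by
    apply isLocalMin_of_deriv_deriv_pos
    · rw [hde.deriv_eq, hd2.deriv]; linarith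
    · rw [hde.eq_of_nhds]; simp
    · exact (hd1 0 (by norm_num)).continuousAt
  filter_upwards [hmin, hpos] with t ht ht2
  have h0 : h 0 = 0 := by simp [hh]
  rw [h0] at ht
  rw [abs_of_pos ht2]
  simp only [hh] at ht
  linarith

lemma pointwise_ineq {p ε : ℝ} (hp : 2 < p) (hε : 0 < ε) : ∃ C : ℝ, 0 < C ∧ ∀ t : ℝ,
    |1+t|^p ≤ 1 + p*t + (p*(p-1)/2+ε)*t^2 + C*|t|^p := by
  obtain ⟨δ, hδ, hb⟩ := Metric.eventually_nhds_iff.1 (pointwise_near hp hε)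
  refine ⟨(1/δ+1)^p + p*δ*(1/δ)^p, by positivity, fun t => ?_⟩
  have hq : 0 ≤ (p*(p-1)/2+ε)*t^2 := by
    have : 0 ≤ p*(p-1) := by nlinarith
    positivity
  rcases lt_or_ge |t| δ with h | h
  · have := hb (y := t) (by simpa using h)
    have : 0 ≤ ((1/δ+1)^p + p*δ*(1/δ)^p)*|t|^p := by positivity
    linarith
  · have h1 : 1 ≤ 1/δ * |t| := by rw [div_mul_eq_mul_div, one_mul, one_le_div hδ]; exact h
    have h2 : |1+t|^p ≤ (1/δ+1)^p * |t|^p := by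
      rw [← Real.mul_rpow (by positivity) (by positivity)]
      apply Real.rpow_le_rpow (abs_nonneg _) _ (by linarith)
      have := abs_add_le 1 t
      rw [abs_one] at this
      linarith
    have h3 : -(p*δ*(1/δ)^p*|t|^p) ≤ p * t := by
      have h4 : 1/δ * |t| ≤ (1/δ)^p*|t|^p := by
        rw [← Real.mul_rpow (by positivity) (by positivity)]
        exact Real.self_le_rpow_of_one_le h1 (by linarith)
      have h5 : |t| ≤ δ * ((1/δ)^p*|t|^p) := by
        calc |t| = δ * (1/δ * |t|) := by field_simp
          _ ≤ _ := by gcongr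
      have h6 := neg_abs_le t
      have : p * (-(δ * ((1/δ)^p*|t|^p))) ≤ p * t := by
        apply mul_le_mul_of_nonneg_left _ (by linarith)
        linarith
      linarith
    linarith

lemma pointwise_lower {p : ℝ} (hp : 2 < p) (t : ℝ) : 1 + p*t ≤ |1+t|^p := by
  rcases le_total (-1) t with h | h
  · rw [abs_of_nonneg (by linarith)]
    exact one_add_mul_self_le_rpow_one_add h (by linarith)
  · have : 0 ≤ |1+t|^p := by positivity
    nlinarith

lemma fCoeff_zero (u : ℝ → ℝ) : fCoeff u 0 = (((2*Real.pi)⁻¹ * ∫ θ in (0:ℝ)..(2*Real.pi), u θ : ℝ) : ℂ) := by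
  unfold fCoeff
  simp [intervalIntegral.integral_ofReal]

lemma fCoeff_neg (u : ℝ → ℝ) (k : ℤ) : fCoeff u (-k) = (starRingEnd ℂ) (fCoeff u k) := by
  unfold fCoeff
  rw [map_mul, intervalIntegral.integral_of_le Real.two_pi_pos.le,
    intervalIntegral.integral_of_le Real.two_pi_pos.le, ← integral_conj]
  congr 1
  · simp [Complex.conj_ofNat]
  · congr 1; ext θ
    rw [map_mul, Complex.conj_ofReal, ← Complex.exp_conj]
    simp

/-- package of facts about a single admissible function -/
structure Adm (s : ℝ) (r : ℝ → ℝ) : Prop where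
  meas : Measurable r
  L2 : IntegrableOn (fun θ => (r θ) ^ 2) (Set.Ioo 0 (2 * Real.pi))
  ne : ¬ r =ᵐ[volume.restrict (Set.Ioo (0:ℝ) (2 * Real.pi))] 0
  coef : ∀ k : ℤ, |k| ≤ 1 → fCoeff r k = 0
  Qfin : Qform s r < ⊤

lemma memLp_of_sq {r : ℝ → ℝ} (hm : Measurable r)
    (h : IntegrableOn (fun θ => (r θ) ^ 2) (Set.Ioo 0 (2 * Real.pi))) :
    MemLp r 2 (volume.restrict (Set.Ioc 0 (2*Real.pi))) := by
  rw [← integrableOn_Ioc_iff_integrableOn_Ioo] at h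
  exact (memLp_two_iff_integrable_sq hm.aestronglyMeasurable).2 h

lemma Adm.memLp {s : ℝ} {r : ℝ → ℝ} (h : Adm s r) :
    MemLp (fun θ => (r θ : ℂ)) 2 (volume.restrict (Set.Ioc 0 (2*Real.pi))) :=
  (memLp_of_sq h.meas h.L2).ofReal

lemma Adm.intble {s : ℝ} {r : ℝ → ℝ} (h : Adm s r) :
    IntegrableOn r (Set.Ioc 0 (2*Real.pi)) :=
  (memLp_of_sq h.meas h.L2).integrable (by norm_num)

lemma Adm.mean {s : ℝ} {r : ℝ → ℝ} (h : Adm s r) : ∫ θ in Set.Ioc 0 (2*Real.pi), r θ = 0 := by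
  have := h.coef 0 (by norm_num)
  rw [fCoeff_zero] at this
  have := Complex.ofReal_eq_zero.1 this
  rw [intervalIntegral.integral_of_le Real.two_pi_pos.le] at this
  simpa [Real.pi_ne_zero] using this

lemma Adm.hasSum_sq {s : ℝ} {r : ℝ → ℝ} (h : Adm s r) :
    HasSum (fun k => ‖fCoeff r k‖^2) ((2*Real.pi)⁻¹ * ∫ x in Set.Ioc 0 (2*Real.pi), r x^2) := by
  have := parseval h.memLp
  rw [intervalIntegral.integral_of_le Real.two_pi_pos.le] at this
  simpa [fCoeff_eq_cC] using this

lemma Adm.hasSum_Q {s : ℝ} (hs : s ∈ Set.Ioo (0:ℝ) (1/2)) {r : ℝ → ℝ} (h : Adm s r) :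
    HasSum (fun k : ℤ => alphaF s k.natAbs * ‖fCoeff r k‖^2)
      ((2*Real.pi)⁻¹ * (Qform s r).toReal) := by
  have h1 : ∑' k : ℤ, ENNReal.ofReal (alphaF s k.natAbs * ‖fCoeff r k‖ ^ 2) ≠ ⊤ := by
    intro ht
    have := h.Qfin
    rw [Qform, ht, ENNReal.mul_top (by simp [Real.pi_pos])] at this
    exact lt_irrefl _ this
  have hnn : ∀ k : ℤ, 0 ≤ alphaF s k.natAbs * ‖fCoeff r k‖ ^ 2 := fun k =>
    mul_nonneg (alphaF_pos hs _).le (by positivity)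
  have hsum : Summable (fun k : ℤ => alphaF s k.natAbs * ‖fCoeff r k‖^2) := by
    have := ENNReal.summable_toReal h1
    refine this.congr fun k => ?_
    rw [ENNReal.toReal_ofReal (hnn k)]
  have : (2*Real.pi)⁻¹ * (Qform s r).toReal = ∑' k : ℤ, alphaF s k.natAbs * ‖fCoeff r k‖^2 := by
    rw [Qform, ← ENNReal.ofReal_tsum_of_nonneg hnn hsum, ENNReal.toReal_mul,
      ENNReal.toReal_ofReal Real.two_pi_pos.le, ENNReal.toReal_ofReal (tsum_nonneg hnn), ← mul_assoc,
      inv_mul_cancel₀ Real.two_pi_pos.ne', one_mul]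
  rw [this]
  exact hsum.hasSum

lemma Qform_of_hasSum {s : ℝ} (hs : s ∈ Set.Ioo (0:ℝ) (1/2)) {r : ℝ → ℝ} {a : ℝ}
    (h : HasSum (fun k : ℤ => alphaF s k.natAbs * ‖fCoeff r k‖^2) a) :
    Qform s r = ENNReal.ofReal (2*Real.pi*a) := by
  have hnn : ∀ k : ℤ, 0 ≤ alphaF s k.natAbs * ‖fCoeff r k‖ ^ 2 := fun k =>
    mul_nonneg (alphaF_pos hs _).le (by positivity)
  rw [Qform, ← ENNReal.ofReal_tsum_of_nonneg hnn h.summable, h.tsum_eq,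
    ENNReal.ofReal_mul Real.two_pi_pos.le]

/-- contribution of frequency two -/
noncomputable def q2 (s : ℝ) (r : ℝ → ℝ) : ℝ := 4*Real.pi*alphaF s 2*‖fCoeff r 2‖^2

lemma hasSum_two (a b : ℝ) (c : ℤ → ℝ) (h2 : c 2 = a) (h3 : c (-2) = b) :
    HasSum (fun k : ℤ => if k = 2 ∨ k = -2 then c k else 0) (a + b) := by
  have := hasSum_sum_of_ne_finset_zero (L := SummationFilter.unconditional ℤ)
    (f := fun k : ℤ => if k = 2 ∨ k = -2 then c k else 0)
    (s := {2, -2}) (by intro k hk; simp at hk; simp [hk])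
  rw [Finset.sum_pair (by norm_num)] at this
  simpa [h2, h3] using this

lemma Adm.hasSum_rest {s : ℝ} (hs : s ∈ Set.Ioo (0:ℝ) (1/2)) {r : ℝ → ℝ} (h : Adm s r) :
    HasSum (fun k : ℤ => if k = 2 ∨ k = -2 then 0 else alphaF s k.natAbs * ‖fCoeff r k‖^2)
      ((2*Real.pi)⁻¹ * ((Qform s r).toReal - q2 s r)) := by
  have h1 := (h.hasSum_Q hs).sub (hasSum_two (alphaF s 2 * ‖fCoeff r 2‖^2)
    (alphaF s 2 * ‖fCoeff r 2‖^2) (fun k : ℤ => alphaF s k.natAbs * ‖fCoeff r k‖^2) (by simp)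
    (by simp [fCoeff_neg]))
  have e1 : (fun k : ℤ => if k = 2 ∨ k = -2 then 0 else alphaF s k.natAbs * ‖fCoeff r k‖^2) =
      fun k : ℤ => alphaF s k.natAbs * ‖fCoeff r k‖^2 -
        if k = 2 ∨ k = -2 then alphaF s k.natAbs * ‖fCoeff r k‖^2 else 0 := by
    ext k; split_ifs <;> simp
  have e2 : (2*Real.pi)⁻¹ * ((Qform s r).toReal - q2 s r) = (2 * π)⁻¹ * (Qform s r).toReal -
      (alphaF s 2 * ‖fCoeff r 2‖ ^ 2 + alphaF s 2 * ‖fCoeff r 2‖ ^ 2) := by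
    rw [q2]; field_simp; ring
  rw [e1, e2]
  exact h1

lemma Adm.L2_le {s : ℝ} (hs : s ∈ Set.Ioo (0:ℝ) (1/2)) {r : ℝ → ℝ} (h : Adm s r) :
    ∫ x in Set.Ioc 0 (2*Real.pi), r x^2 ≤
      q2 s r / alphaF s 2 + ((Qform s r).toReal - q2 s r) / alphaF s 3 := by
  have hα2 := alphaF_pos hs 2
  have hα3 := alphaF_pos hs 3
  have h1 := hasSum_two (‖fCoeff r 2‖^2) (‖fCoeff r 2‖^2) (fun k : ℤ => ‖fCoeff r k‖^2) (by simp)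
    (by simp [fCoeff_neg])
  have h2 := h1.add ((h.hasSum_rest hs).mul_left (alphaF s 3)⁻¹)
  have h3 := hasSum_le (fun k => ?_) h.hasSum_sq h2
  · rw [inv_mul_le_iff₀ Real.two_pi_pos] at h3
    refine h3.trans (le_of_eq ?_)
    rw [q2]; field_simp; ring
  · split_ifs with hk
    · simp
    · by_cases hk1 : |k| ≤ 1
      · simp [h.coef k hk1]
      · have : 3 ≤ k.natAbs := by
          push Not at hk
          rcases abs_cases k with ⟨ha, _⟩ | ⟨ha, _⟩ <;> omega
        have hm := (alphaF_strictMono hs).monotone this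
        rw [zero_add, ← div_eq_inv_mul, le_div_iff₀ hα3, mul_comm]
        gcongr

lemma Adm.q2_le {s : ℝ} (hs : s ∈ Set.Ioo (0:ℝ) (1/2)) {r : ℝ → ℝ} (h : Adm s r) :
    q2 s r ≤ (Qform s r).toReal := by
  have := (h.hasSum_rest hs).nonneg (fun k => by
    have := alphaF_pos hs k.natAbs
    split_ifs <;> positivity)
  have h2 : 0 < (2*Real.pi)⁻¹ := inv_pos.2 Real.two_pi_pos
  have := nonneg_of_mul_nonneg_right this h2
  linarith

lemma q2_nonneg {s : ℝ} (hs : s ∈ Set.Ioo (0:ℝ) (1/2)) (r : ℝ → ℝ) : 0 ≤ q2 s r := by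
  have := alphaF_pos hs 2
  unfold q2; positivity

lemma Adm.Q_pos {s : ℝ} (hs : s ∈ Set.Ioo (0:ℝ) (1/2)) {r : ℝ → ℝ} (h : Adm s r) :
    0 < (Qform s r).toReal := by
  by_contra hc
  have hq := h.q2_le hs
  have hq2 := q2_nonneg hs r
  have hL := h.L2_le hs
  have hz : (Qform s r).toReal = 0 := le_antisymm (not_lt.1 hc) ENNReal.toReal_nonneg
  have hz2 : q2 s r = 0 := by linarith
  rw [hz, hz2] at hL
  simp only [zero_div, sub_zero, add_zero] at hL
  have hi : IntegrableOn (fun θ => (r θ) ^ 2) (Set.Ioc 0 (2 * Real.pi)) :=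
    (integrableOn_Ioc_iff_integrableOn_Ioo).2 h.L2
  have h0 := (integral_eq_zero_iff_of_nonneg (fun x => sq_nonneg (r x)) hi).1
    (le_antisymm hL (integral_nonneg fun x => sq_nonneg (r x)))
  apply h.ne
  rw [← restrict_Ioo_eq_restrict_Ioc] at h0
  filter_upwards [h0] with x hx
  simpa using hx

lemma Adm.Q_add {s : ℝ} (hs : s ∈ Set.Ioo (0:ℝ) (1/2)) {r : ℝ → ℝ} (h : Adm s r) :
    (Qform s (fun θ => 1 + r θ)).toReal = 2*Real.pi*alphaF s 0 + (Qform s r).toReal := by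
  have hc : ∀ k, fCoeff (fun θ => 1 + r θ) k = if k = 0 then 1 else fCoeff r k := by
    intro k
    rw [fCoeff_eq_cC]
    push_cast
    have h1 := cC_exp 0 k
    simp only [Int.cast_zero, mul_zero, zero_mul, Complex.exp_zero] at h1
    rw [cC_add (intervalIntegrable_const), h1, ← fCoeff_eq_cC]
    · split_ifs with hk
      · rw [hk, h.coef 0 (by norm_num)]; simp
      · simp
    · rw [intervalIntegrable_iff_integrableOn_Ioc_of_le Real.two_pi_pos.le]
      exact h.intble.ofReal
  have h2 := (hasSum_ite_eq (0:ℤ) (alphaF s 0)).add (h.hasSum_Q hs)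
  have h3 : HasSum (fun k : ℤ => alphaF s k.natAbs * ‖fCoeff (fun θ => 1 + r θ) k‖^2)
      (alphaF s 0 + (2*Real.pi)⁻¹ * (Qform s r).toReal) := by
    convert h2 using 1
    ext k
    rw [hc]
    split_ifs with hk
    · rw [hk, h.coef 0 (by norm_num)]; simp
    · simp
  rw [Qform_of_hasSum hs h3, ENNReal.toReal_ofReal]
  · field_simp
  · have := alphaF_pos hs 0
    have : 0 ≤ (Qform s r).toReal := ENNReal.toReal_nonneg
    positivity

/-- the deficit -/
noncomputable def defi (s : ℝ) (r : ℝ → ℝ) : ℝ :=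
  (Qform s (fun θ => 1 + r θ)).toReal -
          (alphaF s 0 * (2 * Real.pi) ^ (2 * s)) *
            (∫ θ in (0:ℝ)..(2 * Real.pi), |1 + r θ| ^ (2 / (1 - 2*s)))
              ^ ((2:ℝ) / (2 / (1 - 2*s)))

lemma sobolev_adm {s : ℝ} (hs : s ∈ Set.Ioo (0:ℝ) (1/2)) : ∃ C : ℝ, 0 < C ∧ ∀ r, Adm s r →
    IntegrableOn (fun θ => |r θ| ^ (2/(1-2*s))) (Set.Ioc 0 (2*Real.pi)) ∧
    ∫ θ in Set.Ioc 0 (2*Real.pi), |r θ| ^ (2/(1-2*s)) ≤ C * (Qform s r).toReal ^ (1/(1-2*s)) := by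
  obtain ⟨C, hC, hS⟩ := sobolev hs
  have hα := alphaF_pos hs 0
  have hd : 0 < 1 - 2*s := by linarith [hs.2]
  refine ⟨C * ((alphaF s 0)⁻¹ * (2*Real.pi)⁻¹) ^ (1/(1-2*s)), by positivity, fun r h => ?_⟩
  have hq := h.Q_pos hs
  have h1 := (h.hasSum_Q hs).mul_left (alphaF s 0)⁻¹
  have h2 := hS (fun θ => (r θ : ℂ)) h.memLp
    ((alphaF s 0)⁻¹ * ((2*Real.pi)⁻¹ * (Qform s r).toReal)) (by positivity) (by
      rw [← h1.tsum_eq, ENNReal.ofReal_tsum_of_nonneg _ h1.summable]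
      · apply ENNReal.tsum_le_tsum
        intro k
        apply ENNReal.ofReal_le_ofReal
        rw [← fCoeff_eq_cC, ← mul_assoc]
        gcongr
        rw [← div_eq_inv_mul, le_div_iff₀ hα, mul_comm]
        exact alphaF_lower hs _
      · intro k
        have := alphaF_pos hs k.natAbs
        positivity)
  simp only [Complex.norm_real, Real.norm_eq_abs] at h2
  have hmeas : AEStronglyMeasurable (fun θ => |r θ| ^ (2/(1-2*s)))
      (volume.restrict (Set.Ioc 0 (2*Real.pi))) :=
    ((h.meas.norm).pow_const _).aestronglyMeasurable
  have hnn : 0 ≤ᵐ[volume.restrict (Set.Ioc 0 (2*Real.pi))] (fun θ => |r θ| ^ (2/(1-2*s))) :=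
    Eventually.of_forall fun θ => by positivity
  constructor
  · refine ⟨hmeas, ?_⟩
    rw [hasFiniteIntegral_iff_ofReal hnn]
    exact h2.trans_lt ENNReal.ofReal_lt_top
  · rw [integral_eq_lintegral_of_nonneg_ae hnn hmeas]
    refine ENNReal.toReal_le_of_le_ofReal (by positivity) (h2.trans (le_of_eq ?_))
    congr 1
    rw [← mul_assoc (alphaF s 0)⁻¹, Real.mul_rpow (by positivity) hq.le]; ring

lemma alphaF_one {s : ℝ} (hs : s ∈ Set.Ioo (0:ℝ) (1/2)) :
    alphaF s 1 = alphaF s 0 * ((1+2*s)/(1-2*s)) := by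
  have hd : 0 < 1 - 2*s := by linarith [hs.2]
  have := alphaF_succ hs 0
  simp only [Nat.cast_zero, zero_add] at this
  rw [this]
  congr 1
  have : (1/2 - s) ≠ 0 := by linarith
  rw [div_eq_div_iff this hd.ne']; ring

lemma alphaF_two {s : ℝ} (hs : s ∈ Set.Ioo (0:ℝ) (1/2)) :
    alphaF s 1 / alphaF s 2 = 1 - 4*s/(3+2*s) := by
  have hα := alphaF_pos hs 1
  have hs1 := hs.1
  have hs2 := hs.2
  have := alphaF_succ hs 1
  simp only [Nat.cast_one, Nat.reduceAdd] at this
  rw [this]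
  have h1 : (1 + 1/2 - s) ≠ 0 := by linarith
  have h2 : (1 + 1/2 + s) ≠ 0 := by linarith
  have h3 : (3 + 2*s) ≠ 0 := by linarith
  rw [div_mul_eq_div_div, div_self hα.ne', one_div_div, div_eq_iff h2]
  field_simp
  ring

lemma key {s : ℝ} (hs : s ∈ Set.Ioo (0:ℝ) (1/2)) {ε : ℝ} (hε : 0 < ε) :
    ∃ C : ℝ, 0 < C ∧ ∀ r, Adm s r → defi s r ≤ (Qform s r).toReal ∧
      (Qform s r).toReal - (alphaF s 1 + ε) * (∫ x in Set.Ioc 0 (2*Real.pi), r x^2)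
        - C * (Qform s r).toReal ^ (1/(1-2*s)) ≤ defi s r := by
  have hs1 := hs.1
  have hs2 := hs.2
  have hd : 0 < 1 - 2*s := by linarith
  have hα := alphaF_pos hs 0
  set p := 2/(1-2*s) with hp
  have hp2 : 2 < p := by
    rw [hp, lt_div_iff₀ hd]; linarith
  obtain ⟨C1, hC1, hS⟩ := sobolev_adm hs
  set ε1 := ε / (alphaF s 0 * (1-2*s)) with hε1
  obtain ⟨C2, hC2, hpt⟩ := pointwise_ineq hp2 (show 0 < ε1 by positivity)
  refine ⟨alphaF s 0 * (1-2*s) * C2 * C1, by positivity, fun r h => ?_⟩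
  obtain ⟨hint, hle⟩ := hS r h
  have hi2 : IntegrableOn (fun θ => (r θ) ^ 2) (Set.Ioc 0 (2 * Real.pi)) :=
    (integrableOn_Ioc_iff_integrableOn_Ioo).2 h.L2
  have hi1 := h.intble
  have hic : IntegrableOn (fun _ => (1:ℝ)) (Set.Ioc 0 (2 * Real.pi)) :=
    integrableOn_const measure_Ioc_lt_top.ne
  have hia : IntegrableOn (fun θ => 1 + p * r θ) (Set.Ioc 0 (2 * Real.pi)) :=
    hic.add (hi1.const_mul p)
  have hib : IntegrableOn (fun θ => 1 + p * r θ + (p*(p-1)/2+ε1) * r θ^2) (Set.Ioc 0 (2 * Real.pi)) :=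
    hia.add (hi2.const_mul _)
  have hid : IntegrableOn (fun θ => 1 + p * r θ + (p*(p-1)/2+ε1) * r θ^2 + C2 * |r θ|^p)
      (Set.Ioc 0 (2 * Real.pi)) :=
    hib.add (hint.const_mul _)
  have hiu : IntegrableOn (fun θ => |1 + r θ|^p) (Set.Ioc 0 (2 * Real.pi)) := by
    refine Integrable.mono' hid (((h.meas.const_add 1).norm).pow_const _).aestronglyMeasurable ?_
    refine Eventually.of_forall fun θ => ?_
    rw [Real.norm_of_nonneg (by positivity)]
    exact hpt (r θ)
  have hone : ∫ θ in Set.Ioc 0 (2*Real.pi), (1:ℝ) = 2*Real.pi := by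
    simp [Real.pi_pos.le]
  have ea : ∫ θ in Set.Ioc 0 (2*Real.pi), (1 + p * r θ) = 2*Real.pi := by
    rw [integral_add hic (hi1.const_mul p), integral_const_mul, h.mean, hone]; simp
  set J := ∫ θ in Set.Ioc 0 (2*Real.pi), |1 + r θ|^p with hJ
  set L := ∫ x in Set.Ioc 0 (2*Real.pi), r x^2 with hL
  set P := ∫ θ in Set.Ioc 0 (2*Real.pi), |r θ| ^ p with hP
  have hJ1 : 2*Real.pi ≤ J := by
    rw [← ea]
    exact integral_mono hia hiu (fun θ => pointwise_lower hp2 (r θ))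
  have hJ2 : J ≤ 2*Real.pi + (p*(p-1)/2+ε1) * L + C2 * P := by
    calc J ≤ ∫ θ in Set.Ioc 0 (2*Real.pi), (1 + p * r θ + (p*(p-1)/2+ε1) * r θ^2 + C2 * |r θ|^p) :=
          integral_mono hiu hid (fun θ => hpt (r θ))
      _ = _ := by
          rw [integral_add hib (hint.const_mul _), integral_add hia (hi2.const_mul _), ea,
            integral_const_mul, integral_const_mul]
  have hexp : (2:ℝ)/p = 1 - 2*s := by rw [hp]; field_simp
  have hdef : defi s r = 2*Real.pi*alphaF s 0 + (Qform s r).toReal -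
      (alphaF s 0 * (2 * Real.pi) ^ (2 * s)) * J ^ (1-2*s) := by
    rw [defi, h.Q_add hs, ← hp, hexp, intervalIntegral.integral_of_le Real.two_pi_pos.le]
  have hpow : (2*Real.pi)^(2*s) * (2*Real.pi)^(1-2*s) = 2*Real.pi := by
    rw [← Real.rpow_add Real.two_pi_pos]; simp
  have hJ3 : (2*Real.pi)^(1-2*s) ≤ J^(1-2*s) := Real.rpow_le_rpow (by positivity) hJ1 hd.le
  have hlow : 2*Real.pi ≤ (2*Real.pi)^(2*s) * J^(1-2*s) := by
    calc 2*Real.pi = (2*Real.pi)^(2*s) * (2*Real.pi)^(1-2*s) := hpow.symm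
      _ ≤ _ := mul_le_mul_of_nonneg_left hJ3 (by positivity)
  have hup : (2*Real.pi)^(2*s) * J^(1-2*s) ≤ 2*Real.pi + (1-2*s) * (J - 2*Real.pi) := by
    have e : J = (2*Real.pi) * (1 + (J - 2*Real.pi)/(2*Real.pi)) := by field_simp; ring
    have hx : 0 ≤ (J - 2*Real.pi)/(2*Real.pi) := div_nonneg (by linarith) (by positivity)
    conv_lhs => rw [e]
    rw [Real.mul_rpow Real.two_pi_pos.le (show 0 ≤ 1 + (J - 2*Real.pi)/(2*Real.pi) by linarith),
      ← mul_assoc, hpow]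
    calc _ ≤ 2*Real.pi * (1 + (1-2*s) * ((J - 2*Real.pi)/(2*Real.pi))) := by
          gcongr
          exact rpow_one_add_le_one_add_mul_self (by linarith) hd.le (by linarith)
      _ = _ := by field_simp
  rw [hdef, mul_assoc (alphaF s 0)]
  constructor
  · have := mul_le_mul_of_nonneg_left hlow hα.le
    linarith
  · have h1 := mul_le_mul_of_nonneg_left hup hα.le
    have h2 : alphaF s 0 * (1-2*s) * (J - 2*Real.pi) ≤
        alphaF s 0 * (1-2*s) * ((p*(p-1)/2+ε1) * L + C2 * (C1 * (Qform s r).toReal ^ (1/(1-2*s)))) := by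
      apply mul_le_mul_of_nonneg_left _ (by positivity)
      have := mul_le_mul_of_nonneg_left hle hC2.le
      linarith
    have h3 : alphaF s 0 * (1-2*s) * (p*(p-1)/2+ε1) = alphaF s 1 + ε := by
      rw [alphaF_one hs, hε1, hp]; field_simp; ring
    have h4 : alphaF s 0 * (1-2*s) * ((p*(p-1)/2+ε1) * L + C2 * (C1 * (Qform s r).toReal ^ (1/(1-2*s))))
       = (alphaF s 1 + ε) * L + alphaF s 0 * (1-2*s) * C2 * C1 * (Qform s r).toReal ^ (1/(1-2*s)) := by
      rw [← h3]; ring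
    linarith

lemma ratio_tendsto {s : ℝ} (hs : s ∈ Set.Ioo (0:ℝ) (1/2)) {ρ : ℕ → ℝ → ℝ} (h : ∀ n, Adm s (ρ n))
    (hQ0 : Tendsto (fun n => Qform s (ρ n)) atTop (nhds 0))
    (hlim : limsup (fun n => defi s (ρ n) / (Qform s (ρ n)).toReal) atTop ≤ 4*s/(3+2*s)) :
    Tendsto (fun n => q2 s (ρ n) / (Qform s (ρ n)).toReal) atTop (nhds 1) := by
  have hs1 := hs.1
  have hs2 := hs.2
  have hd : 0 < 1 - 2*s := by linarith
  have hα1 := alphaF_pos hs 1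
  have hα2 := alphaF_pos hs 2
  have hα3 := alphaF_pos hs 3
  have hα23 : alphaF s 2 < alphaF s 3 := alphaF_lt_succ hs 2
  have hinv : (alphaF s 3)⁻¹ < (alphaF s 2)⁻¹ := inv_strictAnti₀ hα2 hα23
  set κ := alphaF s 1 * ((alphaF s 2)⁻¹ - (alphaF s 3)⁻¹) with hκ
  have hκpos : 0 < κ := mul_pos hα1 (by linarith)
  set K := 2 + (alphaF s 2)⁻¹ with hK
  have hKpos : 0 < K := by positivity
  have hq0 : Tendsto (fun n => (Qform s (ρ n)).toReal) atTop (nhds 0) := by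
    have := (ENNReal.tendsto_toReal (ENNReal.zero_ne_top)).comp hQ0
    simpa [Function.comp_def] using this
  have hbdd : IsBoundedUnder (· ≤ ·) atTop (fun n => defi s (ρ n) / (Qform s (ρ n)).toReal) := by
    obtain ⟨C, _, hC⟩ := key hs one_pos
    refine isBoundedUnder_of ⟨1, fun n => ?_⟩
    rw [div_le_one ((h n).Q_pos hs)]
    exact (hC _ (h n)).1
  rw [Metric.tendsto_atTop]
  intro e he
  set ε := e * κ / (2*K) with hε
  have hεpos : 0 < ε := by positivity
  obtain ⟨C, hC, hk⟩ := key hs hεpos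
  have hev1 : ∀ᶠ n in atTop, defi s (ρ n) / (Qform s (ρ n)).toReal < 4*s/(3+2*s) + ε :=
    eventually_lt_of_limsup_lt (by linarith) hbdd
  have hev2 : ∀ᶠ n in atTop, C * (Qform s (ρ n)).toReal ^ (2*s/(1-2*s)) < ε := by
    have hpos : 0 < 2*s/(1-2*s) := by positivity
    have := (hq0.rpow_const (p := 2*s/(1-2*s)) (Or.inr hpos.le)).const_mul C
    rw [Real.zero_rpow hpos.ne', mul_zero] at this
    exact this.eventually (gt_mem_nhds hεpos)
  obtain ⟨N, hN⟩ := eventually_atTop.1 (hev1.and hev2)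
  refine ⟨N, fun n hn => ?_⟩
  obtain ⟨h1, h2⟩ := hN n hn
  have hq := (h n).Q_pos hs
  have hL := (h n).L2_le hs
  have hle := (h n).q2_le hs
  have hk2 := (hk _ (h n)).2
  set q := (Qform s (ρ n)).toReal with hqdef
  set x := q2 s (ρ n) / q with hx
  have hx1 : x ≤ 1 := by rw [hx, div_le_one hq]; exact hle
  have hx0 : 0 ≤ x := div_nonneg (q2_nonneg hs _) hq.le
  have hxq : q2 s (ρ n) = x * q := by rw [hx]; field_simp
  rw [div_lt_iff₀ hq] at h1
  have hpw : q ^ (1/(1-2*s)) = q ^ (2*s/(1-2*s)) * q := by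
    rw [← Real.rpow_add_one hq.ne']; congr 1; field_simp; ring
  rw [hpw] at hk2
  rw [hxq] at hL
  have h3 : (alphaF s 1 + ε) * (∫ x in Set.Ioc 0 (2*Real.pi), ρ n x^2) ≤
      (alphaF s 1 + ε) * (x * q / alphaF s 2 + (q - x*q)/alphaF s 3) :=
    mul_le_mul_of_nonneg_left hL (by positivity)
  have h4 : C * (q ^ (2*s/(1-2*s)) * q) ≤ ε * q := by
    rw [← mul_assoc]; exact mul_le_mul_of_nonneg_right h2.le hq.le
  have h5 : q * (1 - (alphaF s 1 + ε) * (x * (alphaF s 2)⁻¹ + (1-x) * (alphaF s 3)⁻¹) - ε) ≤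
      q * (4*s/(3+2*s) + ε) := by
    have : (alphaF s 1 + ε) * (x * q / alphaF s 2 + (q - x*q)/alphaF s 3) =
      q * ((alphaF s 1 + ε) * (x * (alphaF s 2)⁻¹ + (1-x) * (alphaF s 3)⁻¹)) := by
      rw [div_eq_mul_inv, div_eq_mul_inv]; ring
    nlinarith
  have h6 := le_of_mul_le_mul_left h5 hq
  have h7 := alphaF_two hs
  rw [div_eq_mul_inv] at h7
  have h8 : x * (alphaF s 2)⁻¹ + (1-x) * (alphaF s 3)⁻¹ ≤ (alphaF s 2)⁻¹ := by nlinarith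
  have h9 : ε * (x * (alphaF s 2)⁻¹ + (1-x) * (alphaF s 3)⁻¹) ≤ ε * (alphaF s 2)⁻¹ :=
    mul_le_mul_of_nonneg_left h8 hεpos.le
  have h10 : κ * (1 - x) ≤ ε * K := by
    rw [hκ, hK]
    nlinarith
  have h11 : ε * K = κ * (e / 2) := by rw [hε]; field_simp
  rw [h11] at h10
  have h12 := le_of_mul_le_mul_left h10 hκpos
  rw [Real.dist_eq, abs_sub_comm, abs_of_nonneg (by linarith)]
  linarith

lemma sin_decomp (c : ℂ) : ∃ θc ∈ Set.Ico (0:ℝ) (2*Real.pi), ∀ θ : ℝ,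
    ((2 * ‖c‖ * Real.sin (2*(θ - θc)) : ℝ) : ℂ) =
      c * Complex.exp (Complex.I * (2:ℤ) * θ) +
        (starRingEnd ℂ) c * Complex.exp (Complex.I * (-2:ℤ) * θ) := by
  set φ := Complex.arg c
  refine ⟨toIcoMod Real.two_pi_pos 0 (-(φ + Real.pi/2)/2), ?_, fun θ => ?_⟩
  · have := toIcoMod_mem_Ico Real.two_pi_pos 0 (-(φ + Real.pi/2)/2)
    simpa using this
  · have e1 : Real.sin (2*(θ - toIcoMod Real.two_pi_pos 0 (-(φ + Real.pi/2)/2))) =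
        Real.cos (2*θ + φ) := by
      set m := toIcoDiv Real.two_pi_pos 0 (-(φ + Real.pi/2)/2)
      have : toIcoMod Real.two_pi_pos 0 (-(φ + Real.pi/2)/2) =
          -(φ + Real.pi/2)/2 - m * (2*Real.pi) := by
        rw [toIcoMod, zsmul_eq_mul]
      rw [this, show 2*(θ - (-(φ + Real.pi/2)/2 - m * (2*Real.pi))) =
        (2*θ + φ + Real.pi/2) + ((2*m : ℤ):ℝ) * (2*Real.pi) by push_cast; ring,
        Real.sin_add_int_mul_two_pi, Real.sin_add_pi_div_two]
    rw [e1]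
    have hcc : c = ‖c‖ * Complex.exp (φ * Complex.I) := (Complex.norm_mul_exp_arg_mul_I c).symm
    have hcs : (starRingEnd ℂ) c = ‖c‖ * Complex.exp (-(φ * Complex.I)) := by
      conv_lhs => rw [hcc]
      rw [map_mul, Complex.conj_ofReal, ← Complex.exp_conj]
      simp
    rw [hcs]
    nth_rewrite 2 [hcc]
    push_cast
    rw [mul_assoc (‖c‖:ℂ), mul_assoc (‖c‖:ℂ), ← Complex.exp_add, ← Complex.exp_add, Complex.cos]
    rw [show (2 * (θ:ℂ) + φ) * Complex.I = φ * Complex.I + Complex.I * 2 * θ by ring,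
      show -(2 * (θ:ℂ) + φ) * Complex.I = -(φ * Complex.I) + Complex.I * (-2) * θ by ring]
    ring

lemma eta_exists {s : ℝ} (hs : s ∈ Set.Ioo (0:ℝ) (1/2)) {r : ℝ → ℝ} (h : Adm s r)
    (hper : Function.Periodic r (2*Real.pi)) (hc : fCoeff r 2 ≠ 0) :
    ∃ θc ∈ Set.Ico (0:ℝ) (2*Real.pi), ∃ η : ℝ → ℝ, Function.Periodic η (2*Real.pi) ∧
      IntegrableOn (fun θ => η θ^2) (Set.Ioo 0 (2*Real.pi)) ∧
      (∀ k : ℤ, |k| ≤ 2 → fCoeff η k = 0) ∧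
      (∀ θ, r θ = (2*‖fCoeff r 2‖) * (Real.sin (2*(θ - θc)) + η θ)) ∧
      Qform s η = ENNReal.ofReal (Real.pi * alphaF s 2 * (((Qform s r).toReal - q2 s r) / q2 s r)) := by
  obtain ⟨θc, hθ, hsin⟩ := sin_decomp (fCoeff r 2)
  have hα2 := alphaF_pos hs 2
  set c := fCoeff r 2 with hcdef
  have hcn : 0 < ‖c‖ := norm_pos_iff.2 hc
  set η : ℝ → ℝ := fun θ => (2*‖c‖)⁻¹ * (r θ) - Real.sin (2*(θ-θc)) with hη
  have hηc : ∀ k, fCoeff η k = if k = 2 ∨ k = -2 then 0 else ((2*‖c‖)⁻¹ : ℂ) * fCoeff r k := by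
    intro k
    have e : (fun θ => (η θ : ℂ)) = fun θ => ((2*‖c‖)⁻¹ : ℂ) * ((r θ : ℂ) +
        ∑ j ∈ ({2,-2} : Finset ℤ), (-fCoeff r j) * Complex.exp (Complex.I * j * θ)) := by
      ext θ
      rw [Finset.sum_pair (by norm_num), fCoeff_neg, ← hcdef, neg_mul, neg_mul, ← neg_add, ← hsin θ]
      simp only [hη]
      push_cast
      have : (‖c‖ : ℂ) ≠ 0 := by exact_mod_cast hcn.ne'
      field_simp
      ring
    rw [fCoeff_eq_cC, e, cC_const_mul, cC_add, cC_trig _ (fun j => -fCoeff r j), ← fCoeff_eq_cC]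
    · by_cases hk : k = 2 ∨ k = -2
      · rw [if_pos hk, if_pos (by simpa using hk)]; simp
      · rw [if_neg hk, if_neg (by simpa using hk)]; simp
    · rw [intervalIntegrable_iff_integrableOn_Ioc_of_le Real.two_pi_pos.le]
      exact h.intble.ofReal
    · exact Continuous.intervalIntegrable (by fun_prop) _ _
  refine ⟨θc, hθ, η, ?_, ?_, ?_, ?_, ?_⟩
  · intro θ
    simp only [hη]
    rw [hper θ, show 2*(θ + 2*Real.pi - θc) = 2*(θ-θc) + ((2:ℤ):ℝ)*(2*Real.pi) by push_cast; ring,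
      Real.sin_add_int_mul_two_pi]
  · have hm : MemLp η 2 (volume.restrict (Set.Ioc 0 (2*Real.pi))) := by
      apply ((memLp_of_sq h.meas h.L2).const_mul _).sub
      exact MemLp.of_bound (by fun_prop) 1 (Eventually.of_forall fun θ => by
        rw [Real.norm_eq_abs]; exact Real.abs_sin_le_one _)
    exact hm.integrable_sq.mono_measure (Measure.restrict_mono Set.Ioo_subset_Ioc_self le_rfl)
  · intro k hk
    rw [hηc]
    split_ifs with hk2
    · rfl
    · rw [h.coef k, mul_zero]
      push Not at hk2
      rcases abs_cases k with ⟨ha, _⟩ | ⟨ha, _⟩ <;> omega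
  · intro θ
    simp only [hη]
    field_simp
    ring
  · have h1 := (h.hasSum_rest hs).mul_left ((2*‖c‖)⁻¹^2)
    have h2 : HasSum (fun k : ℤ => alphaF s k.natAbs * ‖fCoeff η k‖^2)
        ((2*‖c‖)⁻¹^2 * ((2*Real.pi)⁻¹ * ((Qform s r).toReal - q2 s r))) := by
      refine h1.congr_fun ?_
      intro k
      rw [hηc]
      split_ifs
      · simp
      · rw [norm_mul, norm_inv, norm_mul, Complex.norm_real, norm_norm]
        simp only [Complex.norm_ofNat]
        ring
    rw [Qform_of_hasSum hs h2]
    congr 1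
    have hq : q2 s r = 4*Real.pi*alphaF s 2*‖c‖^2 := rfl
    generalize q2 s r = Q at *
    subst hq
    field_simp
    norm_num

/-- Refined decomposition of an almost-minimizing sequence near the constant function `1`:
`ρ_n = μ_n (sin(2(θ - θ_n)) + η_n)` with `μ_n → 0`, `Q(η_n) → 0` and `η_n ∈ E_{≥3}`. -/
theorem decomposition_of_almost_minimizing_sequence
    (s : ℝ) (hs : s ∈ Set.Ioo (0:ℝ) (1/2)) (ρ : ℕ → ℝ → ℝ)
    (hmeas : ∀ n, Measurable (ρ n))
    (hper : ∀ n, Function.Periodic (ρ n) (2 * Real.pi))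
    (hL2 : ∀ n, IntegrableOn (fun θ => (ρ n θ) ^ 2) (Set.Ioo 0 (2 * Real.pi)))
    (hne : ∀ n, ¬ (ρ n) =ᵐ[volume.restrict (Set.Ioo (0:ℝ) (2 * Real.pi))] 0)
    (hcoef : ∀ n, ∀ k : ℤ, |k| ≤ 1 → fCoeff (ρ n) k = 0)
    (hQfin : ∀ n, Qform s (ρ n) < ⊤)
    (hQ0 : Tendsto (fun n => Qform s (ρ n)) atTop (nhds 0))
    (hlimsup : limsup (fun n =>
        ((Qform s (fun θ => 1 + ρ n θ)).toReal -
          (alphaF s 0 * (2 * Real.pi) ^ (2 * s)) *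
            (∫ θ in (0:ℝ)..(2 * Real.pi), |1 + ρ n θ| ^ (2 / (1 - 2*s)))
              ^ ((2:ℝ) / (2 / (1 - 2*s)))) /
        (Qform s (ρ n)).toReal) atTop ≤ 4 * s / (3 + 2 * s)) :
    ∃ (N : ℕ) (θc : ℕ → ℝ) (μ : ℕ → ℝ) (η : ℕ → ℝ → ℝ),
      (∀ n, θc n ∈ Set.Ico (0:ℝ) (2 * Real.pi)) ∧
      (∀ n, 0 < μ n) ∧
      (∀ n, Function.Periodic (η n) (2 * Real.pi)) ∧
      (∀ n, IntegrableOn (fun θ => (η n θ) ^ 2) (Set.Ioo 0 (2 * Real.pi))) ∧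
      (∀ n, ∀ k : ℤ, |k| ≤ 2 → fCoeff (η n) k = 0) ∧
      (∀ n, N ≤ n → ∀ᵐ θ : ℝ, ρ n θ = μ n * (Real.sin (2 * (θ - θc n)) + η n θ)) ∧
      Tendsto μ atTop (nhds 0) ∧
      Tendsto (fun n => Qform s (η n)) atTop (nhds 0) := by
  classical
  have hA : ∀ n, Adm s (ρ n) := fun n => ⟨hmeas n, hL2 n, hne n, hcoef n, hQfin n⟩
  have hα2 := alphaF_pos hs 2
  have hrat := ratio_tendsto hs hA hQ0 hlimsup
  have hq0 : Tendsto (fun n => (Qform s (ρ n)).toReal) atTop (nhds 0) := by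
    have := (ENNReal.tendsto_toReal (ENNReal.zero_ne_top)).comp hQ0
    simpa [Function.comp_def] using this
  have hex : ∀ n, ∃ (θc : ℝ) (μ : ℝ) (η : ℝ → ℝ), θc ∈ Set.Ico (0:ℝ) (2*Real.pi) ∧ 0 < μ ∧
      Function.Periodic η (2*Real.pi) ∧ IntegrableOn (fun θ => η θ^2) (Set.Ioo 0 (2*Real.pi)) ∧
      (∀ k : ℤ, |k| ≤ 2 → fCoeff η k = 0) ∧
      (fCoeff (ρ n) 2 ≠ 0 → (∀ θ, ρ n θ = μ * (Real.sin (2*(θ - θc)) + η θ)) ∧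
        μ = 2 * ‖fCoeff (ρ n) 2‖ ∧
        Qform s η = ENNReal.ofReal (Real.pi * alphaF s 2 *
          (((Qform s (ρ n)).toReal - q2 s (ρ n)) / q2 s (ρ n)))) := by
    intro n
    by_cases hc : fCoeff (ρ n) 2 = 0
    · refine ⟨0, 1, fun _ => 0, ⟨le_rfl, Real.two_pi_pos⟩, one_pos, fun _ => rfl, by simp, ?_,
        fun h => absurd hc h⟩
      intro k _
      simp [fCoeff]
    · obtain ⟨θc, h1, η, h2, h3, h4, h5, h6⟩ := eta_exists hs (hA n) (hper n) hc
      exact ⟨θc, 2 * ‖fCoeff (ρ n) 2‖, η, h1, by positivity, h2, h3, h4, fun _ => ⟨h5, rfl, h6⟩⟩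
  choose θc μ η h1 h2 h3 h4 h5 h6 using hex
  have hev : ∀ᶠ n in atTop, fCoeff (ρ n) 2 ≠ 0 := by
    filter_upwards [hrat.eventually (lt_mem_nhds (zero_lt_one))] with n hn hc
    simp [q2, hc] at hn
  obtain ⟨N, hN⟩ := eventually_atTop.1 hev
  refine ⟨N, θc, μ, η, h1, h2, h3, h4, h5,
    fun n hn => Eventually.of_forall (h6 n (hN n hn)).1, ?_, ?_⟩
  · have hsq : Tendsto (fun n => Real.sqrt ((Qform s (ρ n)).toReal / (Real.pi * alphaF s 2)))
        atTop (nhds 0) := by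
      have := (hq0.div_const (Real.pi * alphaF s 2)).sqrt
      simpa using this
    refine squeeze_zero' (Eventually.of_forall fun n => (h2 n).le) ?_ hsq
    filter_upwards [hev] with n hn
    apply Real.le_sqrt_of_sq_le
    rw [le_div_iff₀ (by positivity), (h6 n hn).2.1]
    refine le_trans (le_of_eq ?_) ((hA n).q2_le hs)
    rw [q2]; ring
  · have hlim : Tendsto (fun n => ENNReal.ofReal (Real.pi * alphaF s 2 *
        ((q2 s (ρ n) / (Qform s (ρ n)).toReal)⁻¹ - 1))) atTop (nhds 0) := by
      have h7 := ((hrat.inv₀ one_ne_zero).sub_const 1).const_mul (Real.pi * alphaF s 2)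
      have := (ENNReal.continuous_ofReal.tendsto _).comp h7
      simpa [Function.comp_def] using this
    refine hlim.congr' ?_
    filter_upwards [hev] with n hn
    rw [(h6 n hn).2.2]
    congr 2
    have hq2 : q2 s (ρ n) ≠ 0 := by
      rw [q2]
      have := norm_pos_iff.2 hn
      positivity
    rw [inv_div, sub_div, div_self hq2]
end

section
/- Let d ≥ 1 be an integer, s ∈ (0, d/2) and p = 2d/(d−2s). Let u_β = v_β + v_{−β} for β ∈ (−1,1), and let ρ : 𝕊^d → ℝ be defined by ρ(ω) = ω_{d+1}² − (1/d)·Σ_{i=1}^d ω_i². Set c₁(β) = 2 − (d/p)·β² + ((d/p)·((d/p)+1)/(d+1))·β² and c₂ = (d/p)·((d/p)+1)·d/(d+1). Then c₂ > 0, c₁(β) → 2 as β → 0, and lim_{β→0} β^{−2} · sup_{ω ∈ 𝕊^d} | u_β(ω) − c₁(β) − c₂·β²·ρ(ω) | = 0; that is, u_β = c₁(β) + c₂β²ρ + o(β²) uniformly on 𝕊^d as β → 0. -/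
open MeasureTheory Real Filter

/-- The Sobolev optimizer `v_β(ω) = (1-β²)^{d/(2p)} (1 - β ω_{d+1})^{-d/p}` on `𝕊^d`. -/
noncomputable def vb (d : ℕ) (p β : ℝ) (ω : EuclideanSpace ℝ (Fin (d+1))) : ℝ :=
  (1 - β^2) ^ ((d:ℝ)/(2*p)) * (1 - β * ω (Fin.last d)) ^ (-(d:ℝ)/p)

/-- The spherical harmonic `ρ(ω) = ω_{d+1}² - (1/d) ∑_{i=1}^d ω_i²`. -/
noncomputable def rhoS (d : ℕ) (ω : EuclideanSpace ℝ (Fin (d+1))) : ℝ :=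
  (ω (Fin.last d))^2 - (1/(d:ℝ)) * ∑ i : Fin d, (ω i.castSucc)^2

/-- Second order Taylor expansion of `(1+x)^b` with cubic remainder. -/
lemma rpow_taylor_aux (b : ℝ) : ∃ K : ℝ, 0 < K ∧ ∀ᶠ x : ℝ in nhds 0,
    |(1 + x) ^ b - (1 + b * x + b * (b - 1) / 2 * x ^ 2)| ≤ K * |x| ^ 3 := by
  have h := (Real.one_add_rpow_hasFPowerSeriesAt_zero (a := b)).isBigO_sub_partialSum_pow 3
  obtain ⟨K, hK, h⟩ := h.exists_pos
  refine ⟨K, hK, ?_⟩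
  filter_upwards [h.bound] with x hx
  have e : (binomialSeries ℝ b).partialSum 3 x = 1 + b * x + b * (b - 1) / 2 * x ^ 2 := by
    have h2 : Ring.choose b 2 = b * (b - 1) / 2 := by
      rw [Ring.choose_eq_smul]
      simp [descPochhammer_succ_right, Polynomial.smeval_mul, Polynomial.smeval_sub,
        Polynomial.smeval_X, Polynomial.smeval_one, Nat.factorial]
      ring
    simp only [FormalMultilinearSeries.partialSum, Finset.sum_range_succ, binomialSeries_apply,
      Ring.choose_one_right, h2, Finset.sum_range_zero]
    simp
    exact Or.inl (by ring)
  rw [e] at hx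
  simpa using hx

lemma err_bound_aux (a C A F B X K1 K2 h : ℝ) (ha : 0 < a) (hC : 0 < C) (hK1 : 0 < K1)
    (hK2 : 0 < K2) (hX0 : 0 ≤ X) (hXB : X ≤ B) (hB1 : B ≤ 1) (hh : h ≤ 1)
    (hBh : B ^ 2 ≤ h)
    (hA : |A - (1 - a / 2 * B)| ≤ K1 * h) (hF : |F - (2 + C * X)| ≤ K2 * h) :
    |A * F - (2 - a * B + C * X)| ≤
      (a / 2 * C + K2 + a / 2 * K2 + K1 * (2 + C + K2)) * h := by
  obtain ⟨r1, rfl⟩ : ∃ r, A = (1 - a / 2 * B) + r := ⟨A - (1 - a / 2 * B), by ring⟩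
  obtain ⟨r2, rfl⟩ : ∃ r, F = (2 + C * X) + r := ⟨F - (2 + C * X), by ring⟩
  rw [add_sub_cancel_left] at hA hF
  have hB0 : 0 ≤ B := hX0.trans hXB
  have h0 : 0 ≤ h := (sq_nonneg B).trans hBh
  have e : (1 - a / 2 * B + r1) * (2 + C * X + r2) - (2 - a * B + C * X)
      = -(a / 2 * C * (B * X)) + r2 + -(a / 2 * B * r2) + r1 * (2 + C * X + r2) := by ring
  rw [e]
  have t1 : |-(a / 2 * C * (B * X))| ≤ a / 2 * C * h := by
    rw [abs_neg, abs_of_nonneg (by positivity)]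
    gcongr
    nlinarith
  have t3 : |-(a / 2 * B * r2)| ≤ a / 2 * 1 * (K2 * h) := by
    rw [abs_neg, abs_mul, abs_of_nonneg (by positivity : 0 ≤ a / 2 * B)]
    gcongr
  have t4 : |r1 * (2 + C * X + r2)| ≤ K1 * h * (2 + C * 1 + K2 * 1) := by
    rw [abs_mul]
    have : |2 + C * X + r2| ≤ 2 + C * 1 + K2 * 1 := by
      refine (abs_add_le _ _).trans ?_
      rw [abs_of_nonneg (by positivity : 0 ≤ 2 + C * X)]
      have : K2 * h ≤ K2 * 1 := by gcongr
      have : C * X ≤ C * 1 := by gcongr; linarith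
      linarith
    gcongr
  have s1 := abs_add_le (-(a / 2 * C * (B * X)) + r2 + -(a / 2 * B * r2)) (r1 * (2 + C * X + r2))
  have s2 := abs_add_le (-(a / 2 * C * (B * X)) + r2) (-(a / 2 * B * r2))
  have s3 := abs_add_le (-(a / 2 * C * (B * X))) r2
  nlinarith

/-- Uniform expansion `u_β = c₁(β) + c₂ β² ρ + o(β²)` on `𝕊^d` as `β → 0`, where
`u_β = v_β + v_{-β}`, `c₁(β) = 2 - (d/p)β² + ((d/p)((d/p)+1)/(d+1))β²` and
`c₂ = (d/p)((d/p)+1)·d/(d+1)`. -/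
theorem two_bubble_expansion (d : ℕ) (hd : 1 ≤ d) (s p : ℝ)
    (hs : s ∈ Set.Ioo (0:ℝ) ((d:ℝ)/2)) (hp : p = 2*(d:ℝ)/((d:ℝ) - 2*s)) :
    0 < ((d:ℝ)/p) * ((d:ℝ)/p + 1) * (d:ℝ) / ((d:ℝ) + 1) ∧
    Tendsto (fun β : ℝ =>
        2 - ((d:ℝ)/p) * β^2 + (((d:ℝ)/p) * ((d:ℝ)/p + 1) / ((d:ℝ) + 1)) * β^2)
      (nhds 0) (nhds 2) ∧
    Tendsto (fun β : ℝ =>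
        (β^2)⁻¹ * ⨆ ω : Metric.sphere (0 : EuclideanSpace ℝ (Fin (d+1))) 1,
          |vb d p β ω + vb d p (-β) ω -
            (2 - ((d:ℝ)/p) * β^2 + (((d:ℝ)/p) * ((d:ℝ)/p + 1) / ((d:ℝ) + 1)) * β^2) -
            (((d:ℝ)/p) * ((d:ℝ)/p + 1) * (d:ℝ) / ((d:ℝ) + 1)) * β^2 * rhoS d ω|)
      (nhdsWithin 0 {(0:ℝ)}ᶜ) (nhds 0) := by
  obtain ⟨hs0, hs1⟩ := hs
  have hd0 : (0:ℝ) < d := by exact_mod_cast hd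
  have hp0 : 0 < p := by rw [hp]; apply div_pos <;> linarith
  obtain ⟨a, haeq⟩ : ∃ a, a = (d:ℝ) / p := ⟨_, rfl⟩
  have ha : 0 < a := haeq ▸ div_pos hd0 hp0
  have e1 : (d:ℝ) / (2 * p) = a / 2 := by rw [haeq]; field_simp
  have e2 : -(d:ℝ) / p = -a := by rw [haeq, neg_div]
  simp only [vb, e1, e2, ← haeq]
  refine ⟨by positivity, ?_, ?_⟩
  · have : Continuous (fun β : ℝ => 2 - a * β^2 + (a * (a + 1) / ((d:ℝ) + 1)) * β^2) := by
      fun_prop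
    simpa using this.tendsto 0
  obtain ⟨K, hK, hKx⟩ := rpow_taylor_aux (-a)
  obtain ⟨L, hL, hLx⟩ := rpow_taylor_aux (a / 2)
  rw [Metric.eventually_nhds_iff] at hKx hLx
  obtain ⟨δ, hδ, hKx⟩ := hKx
  obtain ⟨η, hη, hLx⟩ := hLx
  simp only [dist_zero_right, Real.norm_eq_abs] at hKx hLx
  obtain ⟨C, hCeq⟩ : ∃ C, C = a * (a + 1) := ⟨_, rfl⟩
  have hC : 0 < C := by rw [hCeq]; positivity
  obtain ⟨K1, hK1eq⟩ : ∃ K1, K1 = |a / 2 * (a / 2 - 1) / 2| + L := ⟨_, rfl⟩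
  have hK1 : 0 < K1 := by rw [hK1eq]; positivity
  obtain ⟨M, hMeq⟩ : ∃ M, M = a / 2 * C + 2 * K + a / 2 * (2 * K) + K1 * (2 + C + 2 * K) :=
    ⟨_, rfl⟩
  have hM : 0 < M := by rw [hMeq]; positivity
  have lim : Tendsto (fun β : ℝ => M * |β|) (nhdsWithin 0 {(0:ℝ)}ᶜ) (nhds 0) := by
    have : Continuous (fun β : ℝ => M * |β|) := by fun_prop
    simpa using (this.tendsto 0).mono_left nhdsWithin_le_nhds
  refine squeeze_zero' (Eventually.of_forall fun β => ?_) ?_ lim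
  · exact mul_nonneg (by positivity) (Real.iSup_nonneg fun _ => abs_nonneg _)
  have small : ∀ᶠ β : ℝ in nhdsWithin 0 {(0:ℝ)}ᶜ, |β| < min 1 (min δ η) := by
    refine nhdsWithin_le_nhds ?_
    have := Metric.ball_mem_nhds (0:ℝ) (by positivity : 0 < min 1 (min δ η))
    filter_upwards [this] with β hβ
    simpa using hβ
  filter_upwards [small, self_mem_nhdsWithin] with β hβ hβ0
  have hβ0 : β ≠ 0 := hβ0
  simp only [lt_min_iff] at hβ
  obtain ⟨hb1, hbδ, hbη⟩ := hβ
  have hbpos : 0 < |β| := abs_pos.mpr hβ0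
  have hsq : |β| ^ 2 = β ^ 2 := sq_abs β
  have hB1 : β ^ 2 ≤ |β| := by rw [← hsq]; nlinarith
  have hh1 : |β| ^ 3 ≤ 1 := pow_le_one₀ hbpos.le hb1.le
  have hB2 : (β ^ 2) ^ 2 ≤ |β| ^ 3 := by
    rw [← hsq, ← pow_mul]
    exact pow_le_pow_of_le_one hbpos.le hb1.le (by norm_num)
  suffices H : (⨆ ω : Metric.sphere (0 : EuclideanSpace ℝ (Fin (d+1))) 1, _) ≤ M * |β| ^ 3 by
    refine (mul_le_mul_of_nonneg_left H (by positivity)).trans (le_of_eq ?_)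
    rw [← hsq]
    field_simp
  refine Real.iSup_le (fun ω => ?_) (by positivity)
  obtain ⟨ω, hω⟩ := ω
  have hω1 : ∑ i : Fin d, (ω i.castSucc) ^ 2 + (ω (Fin.last d)) ^ 2 = 1 := by
    rw [← Fin.sum_univ_castSucc (fun i => (ω i) ^ 2), ← EuclideanSpace.real_norm_sq_eq]
    rw [mem_sphere_zero_iff_norm] at hω
    rw [hω]; norm_num
  simp only [rhoS]
  have hS : 0 ≤ ∑ i : Fin d, (ω i.castSucc) ^ 2 := Finset.sum_nonneg fun i _ => sq_nonneg _
  generalize hSe : ∑ i : Fin d, (ω i.castSucc) ^ 2 = S at hS hω1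
  generalize ω (Fin.last d) = t at hω1
  have hS' : S = 1 - t ^ 2 := by linarith
  have ht : |t| ≤ 1 := by rw [← sq_le_one_iff_abs_le_one]; linarith
  have hx : |β * t| ≤ |β| := by
    rw [abs_mul]; exact mul_le_of_le_one_right hbpos.le ht
  have f1 := hKx (y := β * t) (hx.trans_lt hbδ)
  have f2 := hKx (y := -(β * t)) (by rw [abs_neg]; exact hx.trans_lt hbδ)
  have f3 := hLx (y := -β ^ 2) (by rw [abs_neg, abs_of_nonneg (sq_nonneg β)]; linarith)
  have hx3 : |β * t| ^ 3 ≤ |β| ^ 3 := pow_le_pow_left₀ (abs_nonneg _) hx 3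
  rw [abs_neg] at f2
  have hF : |((1 + -(β * t)) ^ (-a) + (1 + β * t) ^ (-a)) - (2 + C * (β ^ 2 * t ^ 2))|
      ≤ 2 * K * |β| ^ 3 := by
    have := abs_add_le ((1 + -(β * t)) ^ (-a)
        - (1 + -a * -(β * t) + -a * (-a - 1) / 2 * (-(β * t)) ^ 2))
      ((1 + β * t) ^ (-a) - (1 + -a * (β * t) + -a * (-a - 1) / 2 * (β * t) ^ 2))
    have hKm : K * |β * t| ^ 3 ≤ K * |β| ^ 3 := by gcongr
    calc _ = _ := by congr 1; rw [hCeq]; ring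
      _ ≤ _ := this
      _ ≤ 2 * K * |β| ^ 3 := by linarith
  have hA : |(1 + -β ^ 2) ^ (a / 2) - (1 - a / 2 * β ^ 2)| ≤ K1 * |β| ^ 3 := by
    have h6 : |-β ^ 2| ^ 3 ≤ |β| ^ 3 := by
      rw [abs_neg, abs_of_nonneg (sq_nonneg β)]
      exact pow_le_pow_left₀ (sq_nonneg β) hB1 3
    have := abs_add_le ((1 + -β ^ 2) ^ (a / 2)
        - (1 + a / 2 * -β ^ 2 + a / 2 * (a / 2 - 1) / 2 * (-β ^ 2) ^ 2))
      (a / 2 * (a / 2 - 1) / 2 * (β ^ 2) ^ 2)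
    have h7 : |a / 2 * (a / 2 - 1) / 2 * (β ^ 2) ^ 2| ≤ |a / 2 * (a / 2 - 1) / 2| * |β| ^ 3 := by
      rw [abs_mul, abs_of_nonneg (sq_nonneg (β ^ 2))]
      gcongr
    have h8 : L * |-β ^ 2| ^ 3 ≤ L * |β| ^ 3 := by gcongr
    calc _ = _ := by congr 1; ring
      _ ≤ _ := this
      _ ≤ K1 * |β| ^ 3 := by rw [hK1eq, add_mul]; linarith
  have ht2 : t ^ 2 ≤ 1 := by linarith
  have key := err_bound_aux a C _ _ (β ^ 2) (β ^ 2 * t ^ 2) K1 (2 * K) (|β| ^ 3) ha hC hK1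
    (by positivity) (by positivity) (mul_le_of_le_one_right (sq_nonneg β) ht2) (by linarith)
    hh1 hB2 hA hF
  rw [← hMeq] at key
  refine le_trans (le_of_eq ?_) key
  have g1 : 1 - β * t = 1 + -(β * t) := by ring
  have g2 : 1 - -β * t = 1 + β * t := by ring
  have g3 : 1 - β ^ 2 = 1 + -β ^ 2 := by ring
  have g4 : 1 - (-β) ^ 2 = 1 + -β ^ 2 := by ring
  rw [g1, g2, g3, g4, hS', hCeq]
  congr 1
  field_simp
  ring
end

section
/- Let d ≥ 1 be an integer and let ρ : 𝕊^d → ℝ be defined by ρ(ω) = ω_{d+1}² − (1/d)·Σ_{i=1}^d ω_i². If d ≥ 2 then ∫_{𝕊^d} ρ(ω)³ dσ(ω) > 0, while for d = 1 one has ∫_{𝕊^1} ρ(ω)³ dσ(ω) = 0. -/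
open MeasureTheory Real

namespace RhoAux

abbrev EE (d : ℕ) := EuclideanSpace ℝ (Fin (d+1))

noncomputable def mS (d : ℕ) : Measure (EE d) :=
  (μH[(d:ℝ)] : Measure (EE d)).restrict (Metric.sphere (0 : EE d) 1)

lemma map_mS (d : ℕ) (e : EE d ≃ₗᵢ[ℝ] EE d) : MeasurePreserving e (mS d) (mS d) := by
  have h := e.toIsometryEquiv.measurePreserving_hausdorffMeasure (d:ℝ)
  have h2 := h.restrict_preimage (s := Metric.sphere (0 : EE d) 1)
    Metric.isClosed_sphere.measurableSet
  have : e.toIsometryEquiv ⁻¹' (Metric.sphere (0 : EE d) 1) = Metric.sphere (0 : EE d) 1 := by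
    ext x; simp
  rw [this] at h2
  exact h2

lemma invar (d : ℕ) (f : ℝ → ℝ) (u v : EE d) (huv : ‖u‖ = ‖v‖) :
    ∫ ω, f (inner ℝ u ω) ∂(mS d) = ∫ ω, f (inner ℝ v ω) ∂(mS d) := by
  set e := (Submodule.reflection (ℝ ∙ (u - v))ᗮ) with he
  have h1 : e u = v := Submodule.reflection_sub huv
  have h2 := (map_mS d e).integral_comp e.toHomeomorph.measurableEmbedding
    (fun ω => f (inner ℝ v ω))
  rw [← h2]
  congr 1
  ext ω
  rw [← h1, e.inner_map_map]

noncomputable def gr (d : ℕ) (y : Fin d → ℝ) : EE d :=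
  WithLp.toLp 2 (Fin.snoc (α := fun _ => ℝ) y (√(1 - ∑ i, (y i)^2)))

lemma gr_contDiffAt (d : ℕ) : ContDiffAt ℝ 1 (gr d) 0 := by
  rw [contDiffAt_euclidean]
  intro i
  refine Fin.lastCases ?_ (fun j => ?_) i
  · simp only [gr, Fin.snoc_last]
    apply ContDiffAt.sqrt
    · fun_prop
    · simp
  · simp only [gr, Fin.snoc_castSucc]
    fun_prop

lemma sum_sq (d : ℕ) (ω : EE d) (h : ω ∈ Metric.sphere (0 : EE d) 1) :
    ∑ i, (ω i)^2 = 1 := by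
  have h1 : ‖ω‖ = 1 := by simpa using h
  have := EuclideanSpace.real_norm_sq_eq ω
  rw [h1] at this
  linarith

lemma exists_north (d : ℕ) : ∃ U : Set (EE d), IsOpen U ∧ EuclideanSpace.single (Fin.last d) (1:ℝ) ∈ U ∧
    mS d U < ⊤ := by
  obtain ⟨K, t, ht, hK⟩ := (gr_contDiffAt d).exists_lipschitzOnWith
  obtain ⟨r, hr, hrt⟩ := Metric.mem_nhds_iff.1 ht
  let P : EE d → (Fin d → ℝ) := fun ω i => ω i.castSucc
  have hP : Continuous P := by fun_prop
  refine ⟨P ⁻¹' (Metric.ball 0 r) ∩ {ω | 0 < ω (Fin.last d)}, ?_, ?_, ?_⟩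
  · exact (Metric.isOpen_ball.preimage hP).inter (isOpen_lt (by fun_prop) (by fun_prop))
  · refine ⟨?_, by simp⟩
    have : P (EuclideanSpace.single (Fin.last d) (1:ℝ)) = 0 := by
      ext i; simp [P, (Fin.castSucc_lt_last i).ne]
    simp [this, hr]
  · rw [mS, Measure.restrict_apply' Metric.isClosed_sphere.measurableSet]
    have hsub : (P ⁻¹' (Metric.ball 0 r) ∩ {ω | 0 < ω (Fin.last d)}) ∩ Metric.sphere (0 : EE d) 1
        ⊆ gr d '' (Metric.ball 0 r) := by
      rintro ω ⟨⟨h1, h2⟩, h3⟩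
      refine ⟨P ω, h1, ?_⟩
      have hs := sum_sq d ω h3
      rw [Fin.sum_univ_castSucc] at hs
      ext i
      refine Fin.lastCases ?_ (fun j => ?_) i
      · simp only [gr, Fin.snoc_last, P]
        rw [show 1 - ∑ i : Fin d, (ω i.castSucc)^2 = (ω (Fin.last d))^2 by linarith]
        exact Real.sqrt_sq (le_of_lt h2)
      · simp [gr, P]
    refine (measure_mono hsub).trans_lt ?_
    refine ((hK.mono hrt).hausdorffMeasure_image_le (Nat.cast_nonneg d)).trans_lt ?_
    have : (μH[(d:ℝ)] : Measure (Fin d → ℝ)) = volume := by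
      have := hausdorffMeasure_pi_real (ι := Fin d)
      simpa using this
    rw [this]
    exact ENNReal.mul_lt_top (ENNReal.rpow_lt_top_of_nonneg (by positivity) (by simp))
      measure_ball_lt_top

instance finite_mS (d : ℕ) : IsFiniteMeasure (mS d) := by
  have h : mS d (Metric.sphere (0 : EE d) 1) < ⊤ := by
    refine (isCompact_sphere _ _).measure_lt_top_of_nhdsWithin ?_
    intro x hx
    obtain ⟨U, hU, hm, hf⟩ := exists_north d
    set e := (Submodule.reflection (ℝ ∙ (x - EuclideanSpace.single (Fin.last d) (1:ℝ)))ᗮ) with he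
    have h1 : e x = EuclideanSpace.single (Fin.last d) (1:ℝ) := by
      refine Submodule.reflection_sub ?_
      simpa using hx
    refine ⟨e ⁻¹' U, ?_, ?_⟩
    · refine mem_nhdsWithin_of_mem_nhds ((hU.preimage e.continuous).mem_nhds ?_)
      simpa [h1] using hm
    · rw [(map_mS d e).measure_preimage hU.measurableSet.nullMeasurableSet]
      exact hf
  constructor
  rw [mS, Measure.restrict_apply_self] at h
  simpa [mS] using h

lemma mS_pos (d : ℕ) : 0 < mS d Set.univ := by
  let P : EE d → (Fin d → ℝ) := fun ω i => ω i.castSucc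
  have hP : LipschitzWith 1 P := by
    refine LipschitzWith.of_dist_le_mul fun x y => ?_
    simp only [NNReal.coe_one, one_mul]
    refine (dist_pi_le_iff dist_nonneg).2 fun i => ?_
    have := PiLp.norm_apply_le (x - y) i.castSucc
    simpa [dist_eq_norm, P] using this
  have h := hP.hausdorffMeasure_image_le (d := (d:ℝ)) (Nat.cast_nonneg d) (Metric.sphere (0 : EE d) 1)
  have hv : (μH[(d:ℝ)] : Measure (Fin d → ℝ)) = volume := by
    have := hausdorffMeasure_pi_real (ι := Fin d)
    simpa using this
  rw [hv] at h
  have hsub : {y : Fin d → ℝ | ∑ i, (y i)^2 < 1} ⊆ P '' (Metric.sphere (0 : EE d) 1) := by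
    intro y hy
    have hy : ∑ i, (y i)^2 < 1 := hy
    refine ⟨gr d y, ?_, ?_⟩
    · have h2 := EuclideanSpace.real_norm_sq_eq (gr d y)
      rw [Fin.sum_univ_castSucc] at h2
      simp only [gr, Fin.snoc_last, Fin.snoc_castSucc] at h2
      rw [Real.sq_sqrt (by linarith)] at h2
      have h3 : ‖gr d y‖ ^ 2 = 1 := by rw [gr, h2]; ring
      have h4 : ‖gr d y‖ = 1 := by
        nlinarith [norm_nonneg (gr d y)]
      simpa using h4
    · ext i; simp [P, gr]
  have ho : IsOpen {y : Fin d → ℝ | ∑ i, (y i)^2 < 1} := isOpen_lt (by fun_prop) (by fun_prop)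
  have hpos : 0 < volume {y : Fin d → ℝ | ∑ i, (y i)^2 < 1} :=
    ho.measure_pos volume ⟨0, by simp⟩
  have := (hpos.trans_le (measure_mono hsub)).trans_le h
  simpa [mS] using this

lemma integ (d : ℕ) (f : C(EE d, ℝ)) : Integrable f (mS d) := by
  have h : IntegrableOn f (Metric.sphere (0 : EE d) 1) (mS d) :=
    f.continuous.continuousOn.integrableOn_compact (isCompact_sphere _ _)
  rw [IntegrableOn, mS, Measure.restrict_restrict Metric.isClosed_sphere.measurableSet,
    Set.inter_self] at h
  exact h

noncomputable def L (d : ℕ) : C(EE d, ℝ) →ₗ[ℝ] ℝ where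
  toFun f := ∫ ω, f ω ∂(mS d)
  map_add' f g := by
    simpa using integral_add (integ d f) (integ d g)
  map_smul' c f := by
    simpa using integral_const_mul c (fun ω => f ω)

lemma L_apply (d : ℕ) (f : C(EE d, ℝ)) : L d f = ∫ ω, f ω ∂(mS d) := rfl

lemma L_congr (d : ℕ) (f g : C(EE d, ℝ))
    (h : ∀ ω ∈ Metric.sphere (0 : EE d) 1, f ω = g ω) : L d f = L d g := by
  rw [L_apply, L_apply, mS]
  exact setIntegral_congr_fun Metric.isClosed_sphere.measurableSet h

noncomputable def X (d : ℕ) (i : Fin (d+1)) : C(EE d, ℝ) := ⟨fun ω => ω i, by fun_prop⟩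

@[simp] lemma X_apply (d : ℕ) (i : Fin (d+1)) (ω : EE d) : X d i ω = ω i := rfl

lemma L_rot (d k : ℕ) (i j : Fin (d+1)) (hij : i ≠ j) (a b : ℝ) (hab : a^2 + b^2 = 1) :
    L d ((a • X d i + b • X d j)^k) = L d (X d i ^ k) := by
  have h := invar d (fun t => t^k) (a • EuclideanSpace.single i (1:ℝ) + b • EuclideanSpace.single j (1:ℝ))
    (EuclideanSpace.single i (1:ℝ)) (by
      have h2 : ‖(a • EuclideanSpace.single i (1:ℝ) + b • EuclideanSpace.single j (1:ℝ) : EE d)‖^2 = 1 := by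
        rw [norm_add_sq_real]
        simp [norm_smul, inner_smul_left, EuclideanSpace.inner_single_left, hij, hij.symm, hab]
      have h3 : ‖(a • EuclideanSpace.single i (1:ℝ) + b • EuclideanSpace.single j (1:ℝ) : EE d)‖ = 1 := by
        have := norm_nonneg (a • EuclideanSpace.single i (1:ℝ) + b • EuclideanSpace.single j (1:ℝ) : EE d)
        nlinarith
      rw [h3]; simp)
  simp only [inner_add_left, inner_smul_left, EuclideanSpace.inner_single_left] at h
  rw [L_apply, L_apply]
  simpa using h

lemma L_swap (d k : ℕ) (i j : Fin (d+1)) (hij : i ≠ j) :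
    L d (X d j ^ k) = L d (X d i ^ k) := by
  simpa using L_rot d k i j hij 0 1 (by norm_num)

lemma L4 (d : ℕ) (i j : Fin (d+1)) (hij : i ≠ j) :
    L d (X d i ^ 4) = 3 * L d (X d i ^ 2 * X d j ^ 2) := by
  have h1 := L_rot d 4 i j hij (3/5) (4/5) (by norm_num)
  have h2 := L_rot d 4 i j hij (3/5) (-(4/5)) (by norm_num)
  have h3 := L_swap d 4 i j hij
  have e : ((3/5:ℝ) • X d i + (4/5:ℝ) • X d j)^4 + ((3/5:ℝ) • X d i + (-(4/5):ℝ) • X d j)^4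
      = (162/625:ℝ) • X d i ^ 4 + (1728/625:ℝ) • (X d i ^ 2 * X d j ^ 2) + (512/625:ℝ) • X d j ^ 4 := by
    ext ω; simp; ring
  have h := congrArg (L d) e
  simp only [map_add, map_smul, smul_eq_mul] at h
  rw [h1, h2, h3] at h
  linarith

lemma L6 (d : ℕ) (i j : Fin (d+1)) (hij : i ≠ j) :
    L d (X d i ^ 6) = 5 * L d (X d i ^ 4 * X d j ^ 2) := by
  have h1 := L_rot d 6 i j hij (3/5) (4/5) (by norm_num)
  have h2 := L_rot d 6 i j hij (3/5) (-(4/5)) (by norm_num)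
  have h3 := L_swap d 6 i j hij
  have h4 := L_rot d 6 i j hij (4/5) (3/5) (by norm_num)
  have h5 := L_rot d 6 i j hij (4/5) (-(3/5)) (by norm_num)
  have key : ∀ a b : ℝ, (a • X d i + b • X d j)^6 + (a • X d i + (-b) • X d j)^6
      = (2*a^6) • X d i ^ 6 + (30*a^4*b^2) • (X d i ^ 4 * X d j ^ 2)
        + (30*a^2*b^4) • (X d i ^ 2 * X d j ^ 4) + (2*b^6) • X d j ^ 6 := by
    intro a b
    ext ω; simp; ring
  have k1 := congrArg (L d) (key (3/5) (4/5))
  have k2 := congrArg (L d) (key (4/5) (3/5))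
  simp only [map_add, map_smul, smul_eq_mul] at k1 k2
  rw [h1, h2, h3] at k1
  rw [h4, h5, h3] at k2
  linarith

lemma L_sum (d : ℕ) (f : C(EE d, ℝ)) :
    ∑ i : Fin d, L d (f * X d i.castSucc ^ 2) + L d (f * X d (Fin.last d) ^ 2) = L d f := by
  rw [← Fin.sum_univ_castSucc (fun i => L d (f * X d i ^ 2)), ← map_sum]
  apply L_congr
  intro ω h
  have := sum_sq d ω h
  simp only [ContinuousMap.coe_sum, Finset.sum_apply, ContinuousMap.mul_apply,
    ContinuousMap.pow_apply, X_apply]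
  rw [← Finset.mul_sum, this, mul_one]

lemma main (d : ℕ) (hd : 1 ≤ d) :
    ∫ ω in Metric.sphere (0 : EE d) 1, (rhoS d ω)^3 ∂μH[(d:ℝ)]
      = 8 * (d - 1) / (d^2 * (d+3) * (d+5)) * (mS d).real Set.univ := by
  have hne : ∀ i : Fin d, Fin.last d ≠ i.castSucc := fun i => (Fin.castSucc_lt_last i).ne'
  have m2 := L_sum d 1
  have m4 := L_sum d (X d (Fin.last d) ^ 2)
  have m6 := L_sum d (X d (Fin.last d) ^ 4)
  have s2 : ∀ i : Fin d, L d (1 * X d i.castSucc ^ 2) = L d (X d (Fin.last d) ^ 2) := fun i => by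
    rw [one_mul]; exact L_swap d 2 _ _ (hne i)
  have s4 : ∀ i : Fin d, L d (X d (Fin.last d) ^ 2 * X d i.castSucc ^ 2)
      = L d (X d (Fin.last d) ^ 4) / 3 := fun i => by
    rw [L4 d _ _ (hne i)]; ring
  have s6 : ∀ i : Fin d, L d (X d (Fin.last d) ^ 4 * X d i.castSucc ^ 2)
      = L d (X d (Fin.last d) ^ 6) / 5 := fun i => by
    rw [L6 d _ _ (hne i)]; ring
  rw [Finset.sum_congr rfl (fun i _ => s2 i), one_mul] at m2
  rw [Finset.sum_congr rfl (fun i _ => s4 i), ← pow_add] at m4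
  rw [Finset.sum_congr rfl (fun i _ => s6 i), ← pow_add] at m6
  simp only [Finset.sum_const, Finset.card_univ, Fintype.card_fin, nsmul_eq_mul] at m2 m4 m6
  norm_num at m4 m6
  have m0 : L d 1 = (mS d).real Set.univ := by
    rw [L_apply]; simp
  have hd0 : (0:ℝ) < d := by exact_mod_cast hd
  have hr : ∫ ω in Metric.sphere (0 : EE d) 1, (rhoS d ω)^3 ∂μH[(d:ℝ)]
      = L d (((d+1:ℝ)^3/d^3) • X d (Fin.last d) ^ 6 + (-3*(d+1:ℝ)^2/d^3) • X d (Fin.last d) ^ 4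
        + (3*(d+1:ℝ)/d^3) • X d (Fin.last d) ^ 2 + (-1/d^3:ℝ) • 1) := by
    rw [L_apply, mS]
    refine setIntegral_congr_fun Metric.isClosed_sphere.measurableSet fun ω h => ?_
    have hs := sum_sq d ω h
    rw [Fin.sum_univ_castSucc] at hs
    have : ∑ i : Fin d, (ω i.castSucc)^2 = 1 - (ω (Fin.last d))^2 := by linarith
    simp [rhoS, this]
    field_simp
    ring
  rw [hr]
  simp only [map_add, map_smul, smul_eq_mul]
  rw [← m0]
  have e2 : L d (X d (Fin.last d) ^ 2) = L d 1 / (d+1) := by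
    rw [← m2]; field_simp
  have e4 : L d (X d (Fin.last d) ^ 4) = 3 * L d (X d (Fin.last d) ^ 2) / (d+3) := by
    rw [← m4]; field_simp
  have e6 : L d (X d (Fin.last d) ^ 6) = 5 * L d (X d (Fin.last d) ^ 4) / (d+5) := by
    rw [← m6]; field_simp
  rw [e6, e4, e2]
  field_simp
  ring

end RhoAux

/-- `∫_{𝕊^d} ρ³ dσ > 0` for `d ≥ 2`, while `∫_{𝕊¹} ρ³ dσ = 0` for `d = 1`. -/
theorem integral_rho_cubed_sign (d : ℕ) (hd : 1 ≤ d) :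
    (2 ≤ d →
      0 < ∫ ω in Metric.sphere (0 : EuclideanSpace ℝ (Fin (d+1))) 1,
            (rhoS d ω)^3 ∂μH[(d:ℝ)]) ∧
    (d = 1 →
      (∫ ω in Metric.sphere (0 : EuclideanSpace ℝ (Fin (d+1))) 1,
          (rhoS d ω)^3 ∂μH[(d:ℝ)]) = 0) := by
  rw [RhoAux.main d hd]
  constructor
  · intro h
    have h1 : 0 < (RhoAux.mS d).real Set.univ :=
      ENNReal.toReal_pos (RhoAux.mS_pos d).ne' (measure_ne_top _ _)
    have h2 : (2:ℝ) ≤ d := by exact_mod_cast h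
    have h3 : (0:ℝ) < d - 1 := by linarith
    positivity
  · rintro rfl
    simp
end

section
/- Let d ≥ 1 be an integer, s ∈ (0, d/2) and p = 2d/(d−2s). For every β, β′ ∈ (−1,1), setting γ = (β − β′)/(1 − ββ′) (which again lies in (−1,1)), one has ∫_{𝕊^d} v_β^{p−1} v_{β′} dσ = ∫_{𝕊^d} v_β v_{β′}^{p−1} dσ = ∫_{𝕊^d} v_γ dσ. -/
open MeasureTheory Real

open scoped NNReal ENNReal Topology

lemma measure_le_of_slices {α : Type*} [MeasurableSpace α] (ν ρ : Measure α) (d : ℕ)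
    (f : α → ℝ≥0) (hf : Measurable f) (hpos : ∀ x, 0 < f x)
    (h : ∀ t : ℝ≥0, 1 < t → ∀ n : ℤ, ∀ B : Set α, MeasurableSet B →
      (∀ x ∈ B, t ^ n ≤ f x ∧ f x ≤ t ^ (n+1)) → ν B ≤ (t : ℝ≥0∞) ^ d * ρ B) : ν ≤ ρ := by
  rw [Measure.le_iff]
  intro B hB
  have key : ∀ t : ℝ≥0, 1 < t → ν B ≤ (t : ℝ≥0∞) ^ d * ρ B := by
    intro t ht
    have ht0 : t ≠ 0 := (zero_lt_one.trans ht).ne'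
    have hf' : Measurable (fun x => (f x : ℝ≥0∞)) := hf.coe_nnreal_ennreal
    have e0 : (fun x => (f x : ℝ≥0∞)) ⁻¹' {0} = ∅ := by
      ext x; simp [(hpos x).ne']
    have e1 : (fun x => (f x : ℝ≥0∞)) ⁻¹' {∞} = ∅ := by
      ext x; simp
    rw [measure_eq_measure_preimage_add_measure_tsum_Ico_zpow ν hf' hB ht,
      measure_eq_measure_preimage_add_measure_tsum_Ico_zpow ρ hf' hB ht, e0, e1]
    simp only [Set.inter_empty, measure_empty, zero_add]
    rw [← ENNReal.tsum_mul_left]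
    refine ENNReal.tsum_le_tsum fun n => h t ht n _ (hB.inter (hf' measurableSet_Ico)) ?_
    rintro x ⟨-, hx⟩
    simp only [Set.mem_preimage, Set.mem_Ico, ← ENNReal.coe_zpow ht0, ENNReal.coe_le_coe,
      ENNReal.coe_lt_coe] at hx
    exact ⟨hx.1, hx.2.le⟩
  have lim : Filter.Tendsto (fun t : ℝ≥0 => (t : ℝ≥0∞) ^ d * ρ B) (𝓝[>] 1)
      (𝓝 ((1 : ℝ≥0∞) ^ d * ρ B)) := by
    refine ENNReal.Tendsto.mul ?_ ?_ tendsto_const_nhds ?_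
    · exact ENNReal.Tendsto.pow (ENNReal.tendsto_coe.2 nhdsWithin_le_nhds)
    · simp
    · simp
  simp only [one_pow, one_mul] at lim
  exact ge_of_tendsto lim (by filter_upwards [self_mem_nhdsWithin] with t ht using key t ht)

lemma map_withDensity_conformal {X : Type*} [MetricSpace X] [MeasurableSpace X] [BorelSpace X]
    (d : ℕ) (T : X ≃ᵐ X) (f : X → ℝ≥0) (hf : Measurable f) (hpos : ∀ x, 0 < f x)
    (hT : ∀ x y, dist (T x) (T y) ^ 2 = f x * f y * dist x y ^ 2) :
    Measure.map T ((μH[(d:ℝ)] : Measure X).withDensity (fun x => ((f x ^ d : ℝ≥0) : ℝ≥0∞)))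
      = μH[(d:ℝ)] := by
  set μ : Measure X := μH[(d:ℝ)] with hμ
  set ρ := μ.withDensity (fun x => ((f x ^ d : ℝ≥0) : ℝ≥0∞)) with hρ
  set ν := Measure.map T.symm μ with hν
  have hνB : ∀ B : Set X, ν B = μ (T '' B) := by
    intro B
    rw [hν, MeasurableEquiv.map_apply, MeasurableEquiv.image_eq_preimage_symm]
  -- bounds on slices
  have b1 : ∀ t : ℝ≥0, ∀ B : Set X, (∀ x ∈ B, f x ≤ t) → ν B ≤ (t : ℝ≥0∞) ^ d * μ B := by
    intro t B hB
    have hL : LipschitzOnWith t T B := by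
      refine LipschitzOnWith.of_dist_le_mul fun x hx y hy => ?_
      refine abs_le_of_sq_le_sq' ?_ (by positivity) |>.2
      rw [hT, mul_pow, sq (t:ℝ)]
      have h1 : (f x : ℝ) ≤ t := by exact_mod_cast hB x hx
      have h2 : (f y : ℝ) ≤ t := by exact_mod_cast hB y hy
      gcongr
    have := hL.hausdorffMeasure_image_le (d := d) (Nat.cast_nonneg d)
    rwa [ENNReal.rpow_natCast, ← hνB] at this
  have b2 : ∀ t : ℝ≥0, 0 < t → ∀ B : Set X, (∀ x ∈ B, t ≤ f x) →
      (t : ℝ≥0∞) ^ d * μ B ≤ ν B := by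
    intro t ht B hB
    have hL : LipschitzOnWith t⁻¹ T.symm (T '' B) := by
      refine LipschitzOnWith.of_dist_le_mul ?_
      rintro _ ⟨x, hx, rfl⟩ _ ⟨y, hy, rfl⟩
      simp only [MeasurableEquiv.symm_apply_apply, NNReal.coe_inv]
      rw [inv_mul_eq_div, le_div_iff₀ (by exact_mod_cast ht)]
      refine abs_le_of_sq_le_sq' ?_ (by positivity) |>.2
      rw [hT, mul_pow, sq (t:ℝ), mul_comm]
      have h1 : (t : ℝ) ≤ f x := by exact_mod_cast hB x hx
      have h2 : (t : ℝ) ≤ f y := by exact_mod_cast hB y hy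
      gcongr
    have := hL.hausdorffMeasure_image_le (d := d) (Nat.cast_nonneg d)
    rw [ENNReal.rpow_natCast, ← hμ, ← hνB, Set.image_image] at this
    simp only [MeasurableEquiv.symm_apply_apply, Set.image_id'] at this
    calc (t : ℝ≥0∞) ^ d * μ B ≤ (t : ℝ≥0∞) ^ d * (((t⁻¹ : ℝ≥0) : ℝ≥0∞) ^ d * ν B) := by gcongr
      _ = ν B := by
        rw [← mul_assoc, ← mul_pow, ← ENNReal.coe_mul, mul_inv_cancel₀ ht.ne']; simp
  have c1 : ∀ t : ℝ≥0, ∀ B : Set X, MeasurableSet B → (∀ x ∈ B, f x ≤ t) →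
      ρ B ≤ (t : ℝ≥0∞) ^ d * μ B := by
    intro t B hBm hB
    rw [hρ, withDensity_apply _ hBm, ← setLIntegral_const]
    refine setLIntegral_mono' hBm fun x hx => ?_
    have := hB x hx
    rw [← ENNReal.coe_pow]
    gcongr
  have c2 : ∀ t : ℝ≥0, ∀ B : Set X, MeasurableSet B → (∀ x ∈ B, t ≤ f x) →
      (t : ℝ≥0∞) ^ d * μ B ≤ ρ B := by
    intro t B hBm hB
    rw [hρ, withDensity_apply _ hBm, ← setLIntegral_const]
    refine setLIntegral_mono' hBm fun x hx => ?_
    have := hB x hx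
    rw [← ENNReal.coe_pow]
    gcongr
  have split : ∀ t : ℝ≥0, 1 < t → ∀ n : ℤ,
      ((t ^ (n+1) : ℝ≥0) : ℝ≥0∞) ^ d = (t : ℝ≥0∞) ^ d * ((t ^ n : ℝ≥0) : ℝ≥0∞) ^ d := by
    intro t ht n
    rw [zpow_add_one₀ (zero_lt_one.trans ht).ne', ENNReal.coe_mul, mul_pow, mul_comm]
  have hνρ : ν = ρ := by
    refine le_antisymm ?_ ?_
    · refine measure_le_of_slices ν ρ d f hf hpos fun t ht n B hBm hB => ?_
      calc ν B ≤ _ := b1 (t ^ (n+1)) B fun x hx => (hB x hx).2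
        _ = (t : ℝ≥0∞) ^ d * (((t ^ n : ℝ≥0) : ℝ≥0∞) ^ d * μ B) := by rw [split t ht, mul_assoc]
        _ ≤ _ := by
          gcongr
          exact c2 _ B hBm fun x hx => (hB x hx).1
    · refine measure_le_of_slices ρ ν d f hf hpos fun t ht n B hBm hB => ?_
      calc ρ B ≤ _ := c1 (t ^ (n+1)) B hBm fun x hx => (hB x hx).2
        _ = (t : ℝ≥0∞) ^ d * (((t ^ n : ℝ≥0) : ℝ≥0∞) ^ d * μ B) := by rw [split t ht, mul_assoc]
        _ ≤ _ := by
          gcongr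
          exact b2 _ (zpow_pos (zero_lt_one.trans ht) n) B fun x hx => (hB x hx).1
  rw [← hνρ, hν, MeasurableEquiv.map_map_symm]

lemma integral_conformal {X : Type*} [MetricSpace X] [MeasurableSpace X] [BorelSpace X]
    (d : ℕ) (T : X ≃ᵐ X) (f : X → ℝ) (hf : Measurable f) (hpos : ∀ x, 0 < f x)
    (hT : ∀ x y, dist (T x) (T y) ^ 2 = f x * f y * dist x y ^ 2) (g : X → ℝ) :
    ∫ x, f x ^ d * g (T x) ∂μH[(d:ℝ)] = ∫ x, g x ∂μH[(d:ℝ)] := by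
  have hc : ∀ x, ((f x).toNNReal : ℝ) = f x := fun x => Real.coe_toNNReal _ (hpos x).le
  have hm : Measurable fun x => (f x).toNNReal := hf.real_toNNReal
  conv_rhs => rw [← map_withDensity_conformal d T (fun x => (f x).toNNReal) hm
    (fun x => Real.toNNReal_pos.2 (hpos x)) (fun x y => by rw [hc, hc, hT]),
    integral_map_equiv, integral_withDensity_eq_integral_smul (hm.pow_const d)]
  simp only [NNReal.smul_def, NNReal.coe_pow, hc, smul_eq_mul]

/-! ### The boost -/

noncomputable def boost0 (d : ℕ) (a : ℝ) (x : EuclideanSpace ℝ (Fin (d+1))) :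
    EuclideanSpace ℝ (Fin (d+1)) :=
  (1 - a * x (Fin.last d))⁻¹ •
    (√(1 - a^2) • x + EuclideanSpace.single (Fin.last d)
      ((x (Fin.last d) - a) - √(1 - a^2) * x (Fin.last d)))

lemma boost0_last (d : ℕ) (a : ℝ) (x : EuclideanSpace ℝ (Fin (d+1))) :
    boost0 d a x (Fin.last d) = (x (Fin.last d) - a) / (1 - a * x (Fin.last d)) := by
  simp [boost0]; ring

lemma boost0_inner (d : ℕ) (a : ℝ) (ha : a ∈ Set.Ioo (-1:ℝ) 1)
    (x y : EuclideanSpace ℝ (Fin (d+1))) :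
    inner ℝ (boost0 d a x) (boost0 d a y) = (1 - a * x (Fin.last d))⁻¹ *
      (1 - a * y (Fin.last d))⁻¹ * ((1 - a^2) * (inner ℝ x y - x (Fin.last d) * y (Fin.last d))
        + (x (Fin.last d) - a) * (y (Fin.last d) - a)) := by
  have hc : √(1 - a^2) ^ 2 = 1 - a^2 := Real.sq_sqrt (by nlinarith [ha.1, ha.2])
  rw [boost0, boost0]
  simp only [inner_smul_left, inner_smul_right, inner_add_left, inner_add_right,
    EuclideanSpace.inner_single_left, EuclideanSpace.inner_single_right]
  simp only [map_inv₀, conj_trivial, PiLp.single_eq_same]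
  generalize √(1 - a^2) = c at hc ⊢
  rw [← hc]
  ring

abbrev Sph (d : ℕ) := Metric.sphere (0 : EuclideanSpace ℝ (Fin (d+1))) 1

lemma sph_last (d : ℕ) (x : Sph d) : |x.1 (Fin.last d)| ≤ 1 := by
  have h := PiLp.norm_apply_le x.1 (Fin.last d)
  rw [mem_sphere_zero_iff_norm.1 x.2] at h
  exact h

lemma sph_pos (d : ℕ) (a : ℝ) (ha : a ∈ Set.Ioo (-1:ℝ) 1) (x : Sph d) :
    0 < 1 - a * x.1 (Fin.last d) := by
  have h := abs_le.1 (sph_last d x)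
  rcases le_total 0 a with h0 | h0 <;> nlinarith [ha.1, ha.2, h.1, h.2]

lemma sph_inner (d : ℕ) (x : Sph d) : inner ℝ x.1 x.1 = (1:ℝ) := by
  rw [real_inner_self_eq_norm_sq, mem_sphere_zero_iff_norm.1 x.2, one_pow]

lemma sph_dist (d : ℕ) (x y : Sph d) : dist x y ^ 2 = 2 - 2 * inner ℝ x.1 y.1 := by
  rw [Subtype.dist_eq, dist_eq_norm, norm_sub_sq_real, mem_sphere_zero_iff_norm.1 x.2,
    mem_sphere_zero_iff_norm.1 y.2]
  ring

lemma boost0_mem (d : ℕ) (a : ℝ) (ha : a ∈ Set.Ioo (-1:ℝ) 1) (x : Sph d) :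
    boost0 d a x.1 ∈ Metric.sphere (0 : EuclideanSpace ℝ (Fin (d+1))) 1 := by
  rw [mem_sphere_zero_iff_norm]
  have h : ‖boost0 d a x.1‖ ^ 2 = 1 := by
    rw [← real_inner_self_eq_norm_sq, boost0_inner d a ha, sph_inner]
    have := (sph_pos d a ha x).ne'
    field_simp
    ring
  nlinarith [norm_nonneg (boost0 d a x.1)]

lemma neg_mem_Ioo (a : ℝ) (ha : a ∈ Set.Ioo (-1:ℝ) 1) : -a ∈ Set.Ioo (-1:ℝ) 1 :=
  ⟨by linarith [ha.2], by linarith [ha.1]⟩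

lemma boost0_inv (d : ℕ) (a : ℝ) (ha : a ∈ Set.Ioo (-1:ℝ) 1) (x : Sph d) :
    boost0 d (-a) (boost0 d a x.1) = x.1 := by
  have hc : √(1 - a^2) ^ 2 = 1 - a^2 := Real.sq_sqrt (by nlinarith [ha.1, ha.2])
  have hc0 : 1 - a^2 ≠ 0 := by nlinarith [ha.1, ha.2]
  have h1 := (sph_pos d a ha x).ne'
  have h2 : 1 - -a * boost0 d a x.1 (Fin.last d) = (1 - a^2) / (1 - a * x.1 (Fin.last d)) := by
    rw [boost0_last]; field_simp; ring
  ext i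
  by_cases hi : i = Fin.last d
  · subst hi
    rw [boost0_last, h2, boost0_last]
    generalize x.1 (Fin.last d) = t at h1 ⊢
    rw [div_div_eq_mul_div, div_eq_iff hc0, sub_mul, div_mul_cancel₀ _ h1]
    ring
  · have e : ∀ (b : ℝ) (y : EuclideanSpace ℝ (Fin (d+1))),
        boost0 d b y i = (1 - b * y (Fin.last d))⁻¹ * (√(1 - b^2) * y i) := by
      intro b y; simp [boost0, hi]
    rw [e, h2, e, neg_sq]
    field_simp
    rw [hc]

lemma boost0_continuous (d : ℕ) (a : ℝ) (ha : a ∈ Set.Ioo (-1:ℝ) 1) :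
    Continuous fun x : Sph d => boost0 d a x.1 := by
  unfold boost0
  refine Continuous.smul (Continuous.inv₀ (by fun_prop) fun x => (sph_pos d a ha x).ne') ?_
  refine Continuous.add (by fun_prop) ?_
  have : (fun x : Sph d => EuclideanSpace.single (Fin.last d)
      ((x.1 (Fin.last d) - a) - √(1 - a^2) * x.1 (Fin.last d))) = fun x : Sph d =>
      ((x.1 (Fin.last d) - a) - √(1 - a^2) * x.1 (Fin.last d)) •
        EuclideanSpace.single (Fin.last d) (1:ℝ) := by
    funext x
    ext i
    simp
  rw [this]
  fun_prop

noncomputable def boost (d : ℕ) (a : ℝ) (ha : a ∈ Set.Ioo (-1:ℝ) 1) : Sph d ≃ᵐ Sph d where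
  toFun x := ⟨boost0 d a x.1, boost0_mem d a ha x⟩
  invFun x := ⟨boost0 d (-a) x.1, boost0_mem d (-a) (neg_mem_Ioo a ha) x⟩
  left_inv x := Subtype.ext (boost0_inv d a ha x)
  right_inv x := Subtype.ext (by
    have := boost0_inv d (-a) (neg_mem_Ioo a ha) x
    rwa [neg_neg] at this)
  measurable_toFun := ((boost0_continuous d a ha).subtype_mk _).measurable
  measurable_invFun := ((boost0_continuous d (-a) (neg_mem_Ioo a ha)).subtype_mk _).measurable

noncomputable def lam (d : ℕ) (a : ℝ) (x : EuclideanSpace ℝ (Fin (d+1))) : ℝ :=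
  √(1 - a^2) / (1 - a * x (Fin.last d))

lemma lam_pos (d : ℕ) (a : ℝ) (ha : a ∈ Set.Ioo (-1:ℝ) 1) (x : Sph d) : 0 < lam d a x.1 :=
  div_pos (Real.sqrt_pos.2 (by nlinarith [ha.1, ha.2])) (sph_pos d a ha x)

lemma boost_dist (d : ℕ) (a : ℝ) (ha : a ∈ Set.Ioo (-1:ℝ) 1) (x y : Sph d) :
    dist (boost d a ha x) (boost d a ha y) ^ 2 = lam d a x.1 * lam d a y.1 * dist x y ^ 2 := by
  have hc : √(1 - a^2) ^ 2 = 1 - a^2 := Real.sq_sqrt (by nlinarith [ha.1, ha.2])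
  rw [sph_dist, sph_dist]
  change 2 - 2 * inner ℝ (boost0 d a x.1) (boost0 d a y.1) = _
  rw [boost0_inner d a ha, lam, lam]
  have h1 := (sph_pos d a ha x).ne'
  have h2 := (sph_pos d a ha y).ne'
  field_simp
  rw [hc]
  ring

lemma integral_boost (d : ℕ) (a : ℝ) (ha : a ∈ Set.Ioo (-1:ℝ) 1) (g : Sph d → ℝ) :
    ∫ x, lam d a x.1 ^ d * g (boost d a ha x) ∂μH[(d:ℝ)] = ∫ x, g x ∂μH[(d:ℝ)] := by
  refine integral_conformal d (boost d a ha) (fun x => lam d a x.1) ?_ (lam_pos d a ha)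
    (boost_dist d a ha) g
  unfold lam
  fun_prop

lemma vb_eq (d : ℕ) (p a : ℝ) (ha : a ∈ Set.Ioo (-1:ℝ) 1) (x : Sph d) :
    vb d p a x.1 = lam d a x.1 ^ ((d:ℝ)/p) := by
  have h0 : 0 ≤ 1 - a^2 := by nlinarith [ha.1, ha.2]
  rw [vb, lam, Real.div_rpow (Real.sqrt_nonneg _) (sph_pos d a ha x).le, Real.sqrt_eq_rpow,
    ← Real.rpow_mul h0, neg_div, Real.rpow_neg (sph_pos d a ha x).le, div_eq_mul_inv]
  congr 2
  ring

lemma gamma_mem (a b : ℝ) (ha : a ∈ Set.Ioo (-1:ℝ) 1) (hb : b ∈ Set.Ioo (-1:ℝ) 1) :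
    0 < 1 - a * b ∧ (a - b) / (1 - a * b) ∈ Set.Ioo (-1:ℝ) 1 := by
  obtain ⟨a1, a2⟩ := ha
  obtain ⟨b1, b2⟩ := hb
  have h : 0 < 1 - a * b := by
    rcases le_total 0 a with h0 | h0 <;> nlinarith
  refine ⟨h, ?_, ?_⟩
  · rw [lt_div_iff₀ h]; nlinarith
  · rw [div_lt_iff₀ h]; nlinarith

lemma lam_cocycle (d : ℕ) (a b : ℝ) (ha : a ∈ Set.Ioo (-1:ℝ) 1) (hb : b ∈ Set.Ioo (-1:ℝ) 1)
    (x : Sph d) :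
    lam d a x.1 = lam d b x.1 * lam d ((a - b) / (1 - a * b)) (boost d b hb x).1 := by
  obtain ⟨h, hγ⟩ := gamma_mem a b ha hb
  have hb0 : 0 < 1 - b^2 := by nlinarith [hb.1, hb.2]
  have hs : √(1 - ((a - b) / (1 - a * b))^2) = √(1 - a^2) * √(1 - b^2) / (1 - a * b) := by
    rw [← Real.sqrt_mul (by nlinarith [ha.1, ha.2]), ← Real.sqrt_sq h.le,
      ← Real.sqrt_div' _ (sq_nonneg _), Real.sqrt_sq h.le]
    congr 1
    field_simp
    ring
  have hc : √(1 - b^2) ^ 2 = 1 - b^2 := Real.sq_sqrt hb0.le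
  have h1 := (sph_pos d a ha x).ne'
  have h2 := (sph_pos d b hb x).ne'
  have h3 : 1 - (a - b) / (1 - a * b) * (boost d b hb x).1 (Fin.last d)
      = (1 - b^2) * (1 - a * x.1 (Fin.last d)) /
        ((1 - a * b) * (1 - b * x.1 (Fin.last d))) := by
    change 1 - (a - b) / (1 - a * b) * boost0 d b x.1 (Fin.last d) = _
    rw [boost0_last]
    field_simp
    ring
  rw [lam, lam, lam, h3, hs]
  generalize x.1 (Fin.last d) = t at h1 h2 ⊢
  generalize √(1 - b^2) = c at hc ⊢
  rw [← hc] at hb0 ⊢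
  have hc0 : c ≠ 0 := by rintro rfl; simp at hb0
  have h' := h.ne'
  generalize 1 - b * t = u at h2 ⊢
  generalize 1 - a * t = w at h1 ⊢
  generalize 1 - a * b = z at h' ⊢
  field_simp

lemma integral_main (d : ℕ) (p : ℝ) (hp : 0 < p) (a b : ℝ) (ha : a ∈ Set.Ioo (-1:ℝ) 1)
    (hb : b ∈ Set.Ioo (-1:ℝ) 1) :
    ∫ x : Sph d, vb d p a x.1 * vb d p b x.1 ^ (p-1) ∂μH[(d:ℝ)]
      = ∫ x : Sph d, vb d p ((a - b) / (1 - a * b)) x.1 ∂μH[(d:ℝ)] := by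
  rw [← integral_boost d b hb (fun x => vb d p ((a - b) / (1 - a * b)) x.1)]
  refine integral_congr_ae (Filter.Eventually.of_forall fun x => ?_)
  have hl := lam_pos d b hb x
  have hγ := (gamma_mem a b ha hb).2
  simp only
  rw [vb_eq d p a ha, vb_eq d p b hb, vb_eq d p _ hγ, lam_cocycle d a b ha hb x,
    Real.mul_rpow hl.le (lam_pos d _ hγ _).le, ← Real.rpow_mul hl.le, mul_right_comm,
    ← Real.rpow_add hl, ← Real.rpow_natCast]
  congr 2
  field_simp
  ring

lemma integral_vb_neg (d : ℕ) (p a : ℝ) :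
    ∫ x : Sph d, vb d p (-a) x.1 ∂μH[(d:ℝ)] = ∫ x : Sph d, vb d p a x.1 ∂μH[(d:ℝ)] := by
  have := integral_conformal d (MeasurableEquiv.neg (Sph d)) (fun _ => 1) measurable_const
    (fun _ => one_pos) (fun x y => by simp [Subtype.dist_eq]) (fun x => vb d p a x.1)
  rw [← this]
  simp [vb]

lemma integral_sphere (d : ℕ) (g : EuclideanSpace ℝ (Fin (d+1)) → ℝ) :
    ∫ x in Metric.sphere (0 : EuclideanSpace ℝ (Fin (d+1))) 1, g x ∂μH[(d:ℝ)]
      = ∫ x : Sph d, g x.1 ∂μH[(d:ℝ)] := by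
  have h := (isometry_subtype_coe (s := Metric.sphere (0 : EuclideanSpace ℝ (Fin (d+1))) 1)
    ).map_hausdorffMeasure (d := (d:ℝ)) (Or.inl (Nat.cast_nonneg d))
  rw [Subtype.range_coe] at h
  rw [← h, (MeasurableEmbedding.subtype_coe Metric.isClosed_sphere.measurableSet).integral_map]

/-- For `γ = (β - β')/(1 - ββ') ∈ (-1,1)` one has
`∫ v_β^{p-1} v_{β'} = ∫ v_β v_{β'}^{p-1} = ∫ v_γ`. -/
theorem interaction_integral_identity (d : ℕ) (hd : 1 ≤ d) (s p : ℝ)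
    (hs : s ∈ Set.Ioo (0:ℝ) ((d:ℝ)/2)) (hp : p = 2*(d:ℝ)/((d:ℝ) - 2*s))
    (β β' : ℝ) (hβ : β ∈ Set.Ioo (-1:ℝ) 1) (hβ' : β' ∈ Set.Ioo (-1:ℝ) 1) :
    (β - β') / (1 - β * β') ∈ Set.Ioo (-1:ℝ) 1 ∧
    (∫ ω in Metric.sphere (0 : EuclideanSpace ℝ (Fin (d+1))) 1,
        vb d p β ω ^ (p-1) * vb d p β' ω ∂μH[(d:ℝ)])
      = (∫ ω in Metric.sphere (0 : EuclideanSpace ℝ (Fin (d+1))) 1,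
          vb d p β ω * vb d p β' ω ^ (p-1) ∂μH[(d:ℝ)]) ∧
    (∫ ω in Metric.sphere (0 : EuclideanSpace ℝ (Fin (d+1))) 1,
        vb d p β ω * vb d p β' ω ^ (p-1) ∂μH[(d:ℝ)])
      = ∫ ω in Metric.sphere (0 : EuclideanSpace ℝ (Fin (d+1))) 1,
          vb d p ((β - β') / (1 - β * β')) ω ∂μH[(d:ℝ)] := by
  have hd0 : (0:ℝ) < d := by exact_mod_cast hd
  have hp0 : 0 < p := by
    rw [hp]
    have := hs.2
    exact div_pos (by linarith) (by linarith)
  have e2 := integral_main d p hp0 β β' hβ hβ'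
  have e1 := integral_main d p hp0 β' β hβ' hβ
  have hn : (β' - β) / (1 - β' * β) = -((β - β') / (1 - β * β')) := by
    rw [mul_comm β' β, ← neg_div, neg_sub]
  rw [hn, integral_vb_neg] at e1
  refine ⟨(gamma_mem β β' hβ hβ').2, ?_, ?_⟩
  · rw [integral_sphere, integral_sphere, e2, ← e1]
    simp only [mul_comm]
  · rw [integral_sphere, integral_sphere, e2]
end
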